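/- arXiv:2301.09036 — 3 statements merged into one kernel-verified Lean document; each statement's English description precedes it below -/
import Mathlib

section
/- Let G be a finite simple 3-regular bipartite graph with m edges. Then M(G,5)·(m−5) = 6·M(G,6) + 2·N(P₂+4K₂) + N(P₃+3K₂). -/
open SimpleGraph

/-- The number of `k`-matchings of a graph `G`: `k`-element sets of pairwise disjoint
edges of `G`, identified with the matching subgraphs of `G` having exactly `k` edges. -/
noncomputable def numMatchings {V : Type*} (G : SimpleGraph V) (k : ℕ) : ℕ :=
  Set.ncard {H : G.Subgraph | H.IsMatching ∧ H.edgeSet.ncard = k}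

/-- The number of subgraphs of `G` isomorphic to the graph `X`. -/
noncomputable def numSubgraphs {V W : Type*} (G : SimpleGraph V) (X : SimpleGraph W) : ℕ :=
  Set.ncard {H : G.Subgraph | Nonempty (H.coe ≃g X)}

/-- A finset of edges, no two of which share a vertex. -/
def EdgesDisjoint {V : Type*} (S : Finset (Sym2 V)) : Prop :=
  ∀ e ∈ S, ∀ f ∈ S, ∀ v, v ∈ e → v ∈ f → e = f

/-- The edge `t` shares no vertex with any other edge of `S`. -/
def IsIsolatedEdge {V : Type*} (S : Finset (Sym2 V)) (t : Sym2 V) : Prop :=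
  ∀ f ∈ S, ∀ v, v ∈ t → v ∈ f → f = t

/-- `S` is the edge set of an injective image of the graph `X`. -/
def IsEdgeCopy {V W : Type*} (X : SimpleGraph W) (S : Finset (Sym2 V)) : Prop :=
  ∃ φ : W → V, Function.Injective φ ∧
    ∀ a b, s(a, b) ∈ S ↔ ∃ x y, X.Adj x y ∧ φ x = a ∧ φ y = b

/-- Two edges of `S` meet, and removing either one leaves disjoint edges. -/
def HasCherry {V : Type*} [DecidableEq V] (S : Finset (Sym2 V)) : Prop :=
  ∃ e ∈ S, ∃ f ∈ S, e ≠ f ∧ (∃ v, v ∈ e ∧ v ∈ f) ∧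
    EdgesDisjoint (S.erase e) ∧ EdgesDisjoint (S.erase f)

/-- Some edge of `S` meets two other edges of `S`, and removing it leaves disjoint edges. -/
def HasBridge {V : Type*} [DecidableEq V] (S : Finset (Sym2 V)) : Prop :=
  ∃ e ∈ S, ∃ f ∈ S, ∃ g ∈ S, e ≠ f ∧ e ≠ g ∧ f ≠ g ∧ (∃ v, v ∈ e ∧ v ∈ f) ∧
    (∃ v, v ∈ e ∧ v ∈ g) ∧ EdgesDisjoint (S.erase e)

section Classification

lemma EdgesDisjoint.mono {V : Type*} {S T : Finset (Sym2 V)} (h : EdgesDisjoint T) (hST : S ⊆ T) :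
    EdgesDisjoint S :=
  fun e he f hf => h e (hST he) f (hST hf)

lemma IsIsolatedEdge.mono {V : Type*} {S T : Finset (Sym2 V)} {t : Sym2 V} (h : IsIsolatedEdge T t)
    (hST : S ⊆ T) : IsIsolatedEdge S t :=
  fun f hf => h f (hST hf)

variable {V : Type*} [DecidableEq V] {S : Finset (Sym2 V)}

lemma edgesDisjoint_or_hasCherry_or_hasBridge {e : Sym2 V} (he : e ∈ S)
    (h : EdgesDisjoint (S.erase e)) : EdgesDisjoint S ∨ HasCherry S ∨ HasBridge S := by
  by_cases h0 : ∀ f ∈ S, ∀ v, v ∈ e → v ∈ f → f = e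
  · left
    intro a ha b hb v hva hvb
    by_cases hae : a = e
    · subst hae; exact (h0 b hb v hva hvb).symm
    by_cases hbe : b = e
    · subst hbe; exact h0 a ha v hvb hva
    exact h a (Finset.mem_erase.2 ⟨hae, ha⟩) b (Finset.mem_erase.2 ⟨hbe, hb⟩) v hva hvb
  push Not at h0
  obtain ⟨f, hf, v, hve, hvf, hfe⟩ := h0
  right
  by_cases h1 : ∀ g ∈ S, g ≠ f → ∀ v, v ∈ e → v ∈ g → g = e
  · left
    refine ⟨e, he, f, hf, Ne.symm hfe, ⟨v, hve, hvf⟩, h, ?_⟩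
    intro a ha b hb w hwa hwb
    obtain ⟨haf, ha⟩ := Finset.mem_erase.1 ha
    obtain ⟨hbf, hb⟩ := Finset.mem_erase.1 hb
    by_cases hae : a = e
    · subst hae; exact (h1 b hb hbf w hwa hwb).symm
    by_cases hbe : b = e
    · subst hbe; exact h1 a ha haf w hwb hwa
    exact h a (Finset.mem_erase.2 ⟨hae, ha⟩) b (Finset.mem_erase.2 ⟨hbe, hb⟩) w hwa hwb
  · right
    push Not at h1
    obtain ⟨g, hg, hgf, w, hwe, hwg, hge⟩ := h1
    exact ⟨e, he, f, hf, g, hg, Ne.symm hfe, Ne.symm hge, Ne.symm hgf, ⟨v, hve, hvf⟩,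
      ⟨w, hwe, hwg⟩, h⟩

lemma EdgesDisjoint.of_erase {t : Sym2 V} (h : EdgesDisjoint (S.erase t))
    (ht : IsIsolatedEdge S t) : EdgesDisjoint S := by
  intro a ha b hb v hva hvb
  by_cases hat : a = t
  · subst hat; exact (ht b hb v hva hvb).symm
  by_cases hbt : b = t
  · subst hbt; exact ht a ha v hvb hva
  exact h a (Finset.mem_erase.2 ⟨hat, ha⟩) b (Finset.mem_erase.2 ⟨hbt, hb⟩) v hva hvb

open Classical in
lemma EdgesDisjoint.card_filter (h : EdgesDisjoint S) :
    (S.filter fun e => EdgesDisjoint (S.erase e)).card = S.card := by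
  rw [Finset.filter_true_of_mem]
  exact fun e _ => h.mono (Finset.erase_subset _ _)

open Classical in
lemma HasCherry.card_filter (h : HasCherry S) :
    (S.filter fun e => EdgesDisjoint (S.erase e)).card = 2 := by
  obtain ⟨e, he, f, hf, hef, ⟨v, hve, hvf⟩, h1, h2⟩ := h
  rw [← Finset.card_pair hef]
  congr 1
  ext g
  simp only [Finset.mem_filter, Finset.mem_insert, Finset.mem_singleton]
  constructor
  · rintro ⟨hg, h⟩
    by_contra! hne
    exact hef (h e (Finset.mem_erase.2 ⟨hne.1.symm, he⟩) f
      (Finset.mem_erase.2 ⟨hne.2.symm, hf⟩) v hve hvf)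
  · rintro (rfl | rfl) <;> exact ⟨‹_›, ‹_›⟩

open Classical in
lemma HasBridge.card_filter (h : HasBridge S) :
    (S.filter fun e => EdgesDisjoint (S.erase e)).card = 1 := by
  obtain ⟨e, he, f, hf, g, hg, hef, heg, hfg, ⟨v, hve, hvf⟩, ⟨w, hwe, hwg⟩, h1⟩ := h
  rw [← Finset.card_singleton e]
  congr 1
  ext a
  simp only [Finset.mem_filter, Finset.mem_singleton]
  constructor
  · rintro ⟨ha, h⟩
    by_contra hne
    by_cases haf : a = f
    · subst haf
      exact heg (h e (Finset.mem_erase.2 ⟨Ne.symm hne, he⟩) g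
        (Finset.mem_erase.2 ⟨hfg.symm, hg⟩) w hwe hwg)
    · exact hef (h e (Finset.mem_erase.2 ⟨Ne.symm hne, he⟩) f
        (Finset.mem_erase.2 ⟨Ne.symm haf, hf⟩) v hve hvf)
  · rintro rfl; exact ⟨he, h1⟩

lemma HasCherry.exists_isolated (h : HasCherry S) (hS : 2 < S.card) :
    ∃ t ∈ S, HasCherry (S.erase t) ∧ IsIsolatedEdge S t := by
  obtain ⟨e, he, f, hf, hef, hv, h1, h2⟩ := h
  obtain ⟨t, ht, htef⟩ := Finset.exists_mem_notMem_of_card_lt_card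
    (lt_of_le_of_lt (Finset.card_le_two (a := e) (b := f)) hS)
  simp only [Finset.mem_insert, Finset.mem_singleton, not_or] at htef
  refine ⟨t, ht, ⟨e, by grind, f, by grind, hef, hv,
    h1.mono (by grind), h2.mono (by grind)⟩, ?_⟩
  intro g hg v hvt hvg
  by_cases hge : g = e
  · exact h2 g (by grind) t (by grind) v hvg hvt
  · exact h1 g (by grind) t (by grind) v hvg hvt

lemma HasBridge.exists_isolated (h : HasBridge S) (hS : 3 < S.card) :
    ∃ t ∈ S, HasBridge (S.erase t) ∧ IsIsolatedEdge S t := by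
  obtain ⟨e, he, f, hf, g, hg, hef, heg, hfg, ⟨v, hve, hvf⟩, ⟨w, hwe, hwg⟩, h1⟩ := h
  obtain ⟨t, ht, htef⟩ := Finset.exists_mem_notMem_of_card_lt_card
    (lt_of_le_of_lt (Finset.card_le_three (a := e) (b := f) (c := g)) hS)
  simp only [Finset.mem_insert, Finset.mem_singleton, not_or] at htef
  refine ⟨t, ht, ⟨e, by grind, f, by grind, g, by grind, hef, heg, hfg, ⟨v, hve, hvf⟩,
    ⟨w, hwe, hwg⟩, h1.mono (by grind)⟩, ?_⟩
  intro a ha x hxt hxa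
  by_cases hae : a = e
  · subst hae
    exfalso
    have hvw : v ≠ w := by
      rintro rfl
      exact hfg (h1 f (by grind) g (by grind) v hvf hwg)
    rw [(Sym2.mem_and_mem_iff hvw).1 ⟨hve, hwe⟩, Sym2.mem_iff] at hxa
    rcases hxa with rfl | rfl
    · exact htef.2.1 (h1 t (by grind) f (by grind) x hxt hvf)
    · exact htef.2.2 (h1 t (by grind) g (by grind) x hxt hwg)
  · exact h1 a (by grind) t (by grind) x hxa hxt

lemma HasCherry.of_erase {t : Sym2 V} (h : HasCherry (S.erase t))
    (ht : IsIsolatedEdge S t) : HasCherry S := by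
  obtain ⟨e, he, f, hf, hef, hv, h1, h2⟩ := h
  rw [Finset.erase_right_comm] at h1 h2
  exact ⟨e, Finset.mem_of_mem_erase he, f, Finset.mem_of_mem_erase hf, hef, hv,
    h1.of_erase (ht.mono (Finset.erase_subset _ _)),
    h2.of_erase (ht.mono (Finset.erase_subset _ _))⟩

lemma HasBridge.of_erase {t : Sym2 V} (h : HasBridge (S.erase t))
    (ht : IsIsolatedEdge S t) : HasBridge S := by
  obtain ⟨e, he, f, hf, g, hg, hef, heg, hfg, hv, hw, h1⟩ := h
  rw [Finset.erase_right_comm] at h1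
  exact ⟨e, Finset.mem_of_mem_erase he, f, Finset.mem_of_mem_erase hf, g,
    Finset.mem_of_mem_erase hg, hef, heg, hfg, hv, hw,
    h1.of_erase (ht.mono (Finset.erase_subset _ _))⟩

end Classification

section EdgeCopies

variable {V W : Type*} [DecidableEq V] {S : Finset (Sym2 V)}

lemma isEdgeCopy_sum_pathGraph_two {X : SimpleGraph W} (hX : ∀ x, ∃ y, X.Adj x y) :
    IsEdgeCopy (X ⊕g pathGraph 2) S ↔
      ∃ t ∈ S, IsEdgeCopy X (S.erase t) ∧ ¬ t.IsDiag ∧ IsIsolatedEdge S t := by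
  constructor
  · rintro ⟨φ, hφ, hS⟩
    refine ⟨s(φ (.inr 0), φ (.inr 1)), (hS _ _).2 ⟨.inr 0, .inr 1, ?_, rfl, rfl⟩,
      ⟨φ ∘ Sum.inl, hφ.comp Sum.inl_injective, ?_⟩, ?_, ?_⟩
    · simp [pathGraph_adj]
    · intro a b
      rw [Finset.mem_erase, hS]
      constructor
      · rintro ⟨hne, x | x, y | y, hxy, rfl, rfl⟩
        · exact ⟨x, y, by simpa using hxy, rfl, rfl⟩
        · simp at hxy
        · simp at hxy
        · exfalso
          fin_cases x <;> fin_cases y <;> simp [pathGraph_adj, Sym2.eq_swap] at hxy hne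
      · rintro ⟨x, y, hxy, rfl, rfl⟩
        refine ⟨?_, .inl x, .inl y, by simpa using hxy, rfl, rfl⟩
        simp [hφ.eq_iff]
    · simp [hφ.eq_iff]
    · intro f
      induction f using Sym2.ind with
      | h a b =>
        intro hf v hv hv'
        obtain ⟨x | x, y | y, hxy, rfl, rfl⟩ := (hS _ _).1 hf
        · simp only [Sym2.mem_iff] at hv hv'
          rcases hv with rfl | rfl <;> simp [hφ.eq_iff] at hv'
        · simp at hxy
        · simp at hxy
        · fin_cases x <;> fin_cases y <;> simp [pathGraph_adj, Sym2.eq_swap] at hxy ⊢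
  · rintro ⟨t, ht, ⟨φ, hφ, hS⟩, hd, hiso⟩
    induction t using Sym2.ind with
    | h a b =>
      have hab : a ≠ b := by simpa using hd
      have key : ∀ x, φ x ∉ s(a, b) := by
        intro x hx
        obtain ⟨y, hy⟩ := hX x
        have := Finset.mem_erase.1 ((hS (φ x) (φ y)).2 ⟨x, y, hy, rfl, rfl⟩)
        exact this.1 (hiso _ this.2 (φ x) hx (Sym2.mem_mk_left _ _))
      simp only [Sym2.mem_iff, not_or] at key
      refine ⟨Sum.elim φ ![a, b], hφ.sumElim ?_ ?_, ?_⟩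
      · intro x y hxy
        fin_cases x <;> fin_cases y <;> simp_all
      · intro x y
        fin_cases y
        · exact (key x).1
        · exact (key x).2
      · intro c d
        by_cases hcd : s(c, d) = s(a, b)
        · rw [hcd]
          simp only [ht, true_iff]
          rcases Sym2.eq_iff.1 hcd with ⟨rfl, rfl⟩ | ⟨rfl, rfl⟩
          · exact ⟨.inr 0, .inr 1, by simp [pathGraph_adj], rfl, rfl⟩
          · exact ⟨.inr 1, .inr 0, by simp [pathGraph_adj], rfl, rfl⟩
        · have : s(c, d) ∈ S ↔ s(c, d) ∈ S.erase s(a, b) := by simp [hcd]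
          rw [this, hS]
          constructor
          · rintro ⟨x, y, hxy, rfl, rfl⟩
            exact ⟨.inl x, .inl y, by simpa using hxy, rfl, rfl⟩
          · rintro ⟨x | x, y | y, hxy, rfl, rfl⟩
            · exact ⟨x, y, by simpa using hxy, rfl, rfl⟩
            · simp at hxy
            · simp at hxy
            · exfalso
              fin_cases x <;> fin_cases y <;> simp [pathGraph_adj, Sym2.eq_swap] at hxy hcd

lemma exists_adj_sum_pathGraph_two {X : SimpleGraph W} (hX : ∀ x, ∃ y, X.Adj x y) :
    ∀ x, ∃ y, (X ⊕g pathGraph 2).Adj x y := by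
  rintro (x | x)
  · obtain ⟨y, hy⟩ := hX x
    exact ⟨.inl y, by simpa using hy⟩
  · fin_cases x
    · exact ⟨.inr 1, by simp [pathGraph_adj]⟩
    · exact ⟨.inr 0, by simp [pathGraph_adj]⟩

lemma exists_adj_pathGraph_three : ∀ x, ∃ y, (pathGraph 3).Adj x y := by
  intro x
  fin_cases x
  · exact ⟨1, by simp [pathGraph_adj]⟩
  · exact ⟨0, by simp [pathGraph_adj]⟩
  · exact ⟨1, by simp [pathGraph_adj]⟩

lemma exists_adj_pathGraph_four : ∀ x, ∃ y, (pathGraph 4).Adj x y := by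
  intro x
  fin_cases x
  · exact ⟨1, by simp [pathGraph_adj]⟩
  · exact ⟨0, by simp [pathGraph_adj]⟩
  · exact ⟨1, by simp [pathGraph_adj]⟩
  · exact ⟨2, by simp [pathGraph_adj]⟩

lemma isEdgeCopy_sum_pathGraph_two_iff {X : SimpleGraph W} (hX : ∀ x, ∃ y, X.Adj x y)
    {Q : Finset (Sym2 V) → Prop} {k n : ℕ} (hkn : k ≤ n)
    (hQ : ∀ S, Q S → k < S.card → ∃ t ∈ S, Q (S.erase t) ∧ IsIsolatedEdge S t)
    (hQ' : ∀ S t, Q (S.erase t) → IsIsolatedEdge S t → Q S)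
    (hXQ : ∀ S : Finset (Sym2 V), (∀ e ∈ S, ¬ e.IsDiag) → (IsEdgeCopy X S ↔ Q S ∧ S.card = n)) :
    ∀ S : Finset (Sym2 V), (∀ e ∈ S, ¬ e.IsDiag) →
      (IsEdgeCopy (X ⊕g pathGraph 2) S ↔ Q S ∧ S.card = n + 1) := by
  intro S hS
  have hS' (t : Sym2 V) : ∀ e ∈ S.erase t, ¬ e.IsDiag :=
    fun e he => hS e (Finset.mem_of_mem_erase he)
  rw [isEdgeCopy_sum_pathGraph_two hX]
  constructor
  · rintro ⟨t, ht, hc, -, hiso⟩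
    obtain ⟨hq, hcard⟩ := (hXQ _ (hS' t)).1 hc
    exact ⟨hQ' S t hq hiso, by rw [← hcard, Finset.card_erase_add_one ht]⟩
  · rintro ⟨hq, hcard⟩
    obtain ⟨t, ht, hqt, hiso⟩ := hQ S hq (by omega)
    refine ⟨t, ht, (hXQ _ (hS' t)).2 ⟨hqt, ?_⟩, hS t ht, hiso⟩
    rw [Finset.card_erase_of_mem ht, hcard, Nat.add_sub_cancel]

lemma isEdgeCopy_pathGraph_three (hS : ∀ e ∈ S, ¬ e.IsDiag) :
    IsEdgeCopy (pathGraph 3) S ↔ HasCherry S ∧ S.card = 2 := by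
  constructor
  · rintro ⟨φ, hφ, h⟩
    have hSeq : S = {s(φ 0, φ 1), s(φ 1, φ 2)} := by
      ext e
      induction e using Sym2.ind with
      | h a b =>
        rw [h]
        simp [Fin.exists_fin_succ, pathGraph_adj]
        grind
    have hne : s(φ 0, φ 1) ≠ s(φ 1, φ 2) := by simp [hφ.eq_iff]
    subst hSeq
    refine ⟨⟨s(φ 0, φ 1), by simp, s(φ 1, φ 2), by simp, hne, ⟨φ 1, by simp⟩, ?_, ?_⟩,
      Finset.card_pair hne⟩ <;> intro e he f hf <;> grind
  · rintro ⟨⟨e, he, f, hf, hef, ⟨v, hve, hvf⟩, -, -⟩, hcard⟩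
    have hSeq : {e, f} = S := Finset.eq_of_subset_of_card_le
      (by simp [Finset.insert_subset_iff, he, hf]) (by rw [hcard, Finset.card_pair hef])
    obtain ⟨u, rfl⟩ := Sym2.mem_iff_exists.1 hve
    obtain ⟨w, rfl⟩ := Sym2.mem_iff_exists.1 hvf
    have h1 := hS _ he
    have h2 := hS _ hf
    simp only [Sym2.mk_isDiag_iff] at h1 h2
    have h3 : u ≠ w := by rintro rfl; exact hef rfl
    refine ⟨![u, v, w], ?_, ?_⟩
    · intro x y hxy
      fin_cases x <;> fin_cases y <;> simp_all
    · intro a b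
      rw [← hSeq]
      simp [Fin.exists_fin_succ, pathGraph_adj]
      grind

lemma isEdgeCopy_pathGraph_four (hS : ∀ e ∈ S, ¬ e.IsDiag) :
    IsEdgeCopy (pathGraph 4) S ↔ HasBridge S ∧ S.card = 3 := by
  constructor
  · rintro ⟨φ, hφ, h⟩
    have hSeq : S = {s(φ 1, φ 2), s(φ 0, φ 1), s(φ 2, φ 3)} := by
      ext e
      induction e using Sym2.ind with
      | h a b =>
        rw [h]
        simp [Fin.exists_fin_succ, pathGraph_adj]
        grind
    have hne : s(φ 1, φ 2) ≠ s(φ 0, φ 1) := by simp [hφ.eq_iff]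
    have hne' : s(φ 1, φ 2) ≠ s(φ 2, φ 3) := by simp [hφ.eq_iff]
    have hne'' : s(φ 0, φ 1) ≠ s(φ 2, φ 3) := by simp [hφ.eq_iff]
    subst hSeq
    refine ⟨⟨s(φ 1, φ 2), by simp, s(φ 0, φ 1), by simp, s(φ 2, φ 3), by simp, hne, hne', hne'',
      ⟨φ 1, by simp⟩, ⟨φ 2, by simp⟩, ?_⟩, Finset.card_eq_three.2 ⟨_, _, _, hne, hne', hne'', rfl⟩⟩
    have hd : ∀ v, v ∈ s(φ 0, φ 1) → v ∉ s(φ 2, φ 3) := by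
      intro v hv
      rcases Sym2.mem_iff.1 hv with rfl | rfl <;> simp [hφ.eq_iff]
    intro e he f hf v hve hvf
    simp only [Finset.mem_erase, Finset.mem_insert, Finset.mem_singleton] at he hf
    rcases he with ⟨he, rfl | rfl | rfl⟩ <;> rcases hf with ⟨hf, rfl | rfl | rfl⟩ <;>
      first | rfl | exact absurd rfl he | exact absurd rfl hf | exact absurd hvf (hd v hve) |
        exact absurd hve (hd v hvf)
  · rintro ⟨⟨e, he, f, hf, g, hg, hef, heg, hfg, ⟨v, hve, hvf⟩, ⟨w, hwe, hwg⟩, h1⟩, hcard⟩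
    have hSeq : {e, f, g} = S := Finset.eq_of_subset_of_card_le
      (by simp [Finset.insert_subset_iff, he, hf, hg])
      (by rw [hcard, Finset.card_eq_three.2 ⟨_, _, _, hef, heg, hfg, rfl⟩])
    have hdis : ∀ x, x ∈ f → x ∉ g := fun x hx hx' =>
      hfg (h1 f (Finset.mem_erase.2 ⟨hef.symm, hf⟩) g (Finset.mem_erase.2 ⟨heg.symm, hg⟩) x hx hx')
    have hvw : v ≠ w := by rintro rfl; exact hdis _ hvf hwg
    obtain rfl := (Sym2.mem_and_mem_iff hvw).1 ⟨hve, hwe⟩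
    obtain ⟨u, rfl⟩ := Sym2.mem_iff_exists.1 hvf
    obtain ⟨x, rfl⟩ := Sym2.mem_iff_exists.1 hwg
    have h2 := hS _ hf
    have h3 := hS _ hg
    simp only [Sym2.mk_isDiag_iff] at h2 h3
    have h4 := hdis v (by simp)
    have h5 := hdis u (by simp)
    simp only [Sym2.mem_iff, not_or] at h4 h5
    refine ⟨![u, v, w, x], ?_, ?_⟩
    · intro x y hxy
      fin_cases x <;> fin_cases y <;> simp_all
    · intro a b
      rw [← hSeq]
      simp [Fin.exists_fin_succ, pathGraph_adj]
      grind

end EdgeCopies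

section Subgraphs

variable {V : Type*} [Fintype V] {G : SimpleGraph V} [DecidableRel G.Adj]

/-- The subgraph of `G` formed by a set of edges and their endpoints. -/
def subgraphOfEdges (S : Finset (Sym2 V)) (hS : S ⊆ G.edgeFinset) : G.Subgraph where
  verts := {v | ∃ w, s(v, w) ∈ S}
  Adj v w := s(v, w) ∈ S
  adj_sub h := by simpa using hS h
  edge_vert h := ⟨_, h⟩
  symm := ⟨fun v w h => by rwa [Sym2.eq_swap]⟩

lemma edgeSet_subgraphOfEdges (S : Finset (Sym2 V)) (hS : S ⊆ G.edgeFinset) :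
    (subgraphOfEdges S hS).edgeSet = S := by
  ext e
  induction e using Sym2.ind with
  | h a b => simp [subgraphOfEdges]

lemma ncard_subgraphs_eq_card_filter (P : G.Subgraph → Prop) (Q : Finset (Sym2 V) → Prop)
    [DecidablePred Q] (hP : ∀ H, P H → ∀ v ∈ H.verts, ∃ w, H.Adj v w)
    (hPQ : ∀ H, P H → ∀ S : Finset (Sym2 V), H.edgeSet = S → Q S)
    (hQP : ∀ S hS, Q S → P (subgraphOfEdges S hS)) :
    {H | P H}.ncard = (G.edgeFinset.powerset.filter Q).card := by
  rw [← Set.ncard_coe_finset]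
  refine Set.ncard_congr (fun H _ => H.edgeSet.toFinite.toFinset) ?_ ?_ ?_
  · intro H hH
    simp only [Finset.coe_filter, Finset.mem_powerset, Set.mem_ofPred_eq]
    refine ⟨?_, hPQ H hH _ (by simp)⟩
    intro e he
    simpa using H.edgeSet_subset (by simpa using he)
  · intro H K hH hK h
    have h' : H.edgeSet = K.edgeSet := by simpa using h
    have hadj (a b : V) : H.Adj a b ↔ K.Adj a b := by
      rw [← Subgraph.mem_edgeSet, h', Subgraph.mem_edgeSet]
    refine Subgraph.ext (Set.ext fun v => ⟨fun hv => ?_, fun hv => ?_⟩) ?_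
    · obtain ⟨w, hw⟩ := hP H hH v hv
      exact K.edge_vert ((hadj _ _).1 hw)
    · obtain ⟨w, hw⟩ := hP K hK v hv
      exact H.edge_vert ((hadj _ _).2 hw)
    · ext a b
      exact hadj a b
  · intro S hS
    simp only [Finset.coe_filter, Finset.mem_powerset, Set.mem_ofPred_eq] at hS
    refine ⟨subgraphOfEdges S hS.1, hQP S hS.1 hS.2, ?_⟩
    ext e
    simp [edgeSet_subgraphOfEdges]

open Classical in
lemma numMatchings_eq_card (k : ℕ) :
    numMatchings G k =
      (G.edgeFinset.powerset.filter fun S => EdgesDisjoint S ∧ S.card = k).card := by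
  refine ncard_subgraphs_eq_card_filter _ _ ?_ ?_ ?_
  · rintro H ⟨hH, -⟩ v hv
    exact (hH hv).exists
  · rintro H ⟨hH, hk⟩ S hS
    have hadj (a b : V) : s(a, b) ∈ S ↔ H.Adj a b := by
      rw [← Subgraph.mem_edgeSet, hS, Finset.mem_coe]
    refine ⟨?_, by rw [← hk, hS, Set.ncard_coe_finset]⟩
    intro e he f hf v hve hvf
    obtain ⟨u, rfl⟩ := Sym2.mem_iff_exists.1 hve
    obtain ⟨w, rfl⟩ := Sym2.mem_iff_exists.1 hvf
    rw [hH.eq_of_adj_left ((hadj _ _).1 he) ((hadj _ _).1 hf)]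
  · rintro S hS ⟨hd, hk⟩
    refine ⟨?_, by rw [edgeSet_subgraphOfEdges, Set.ncard_coe_finset, hk]⟩
    rintro v ⟨w, hw⟩
    refine ⟨w, hw, fun u hu => ?_⟩
    exact Sym2.congr_right.1 (hd _ hu _ hw v (Sym2.mem_mk_left _ _) (Sym2.mem_mk_left _ _))

open Classical in
lemma numSubgraphs_eq_card {W : Type*} {X : SimpleGraph W} (hX : ∀ x, ∃ y, X.Adj x y) :
    numSubgraphs G X = (G.edgeFinset.powerset.filter fun S => IsEdgeCopy X S).card := by
  refine ncard_subgraphs_eq_card_filter _ _ ?_ ?_ ?_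
  · rintro H ⟨φ⟩ v hv
    obtain ⟨y, hy⟩ := hX (φ ⟨v, hv⟩)
    refine ⟨φ.symm y, ?_⟩
    have : H.coe.Adj ⟨v, hv⟩ (φ.symm y) := by
      rw [← φ.map_adj_iff]; simpa using hy
    exact this
  · rintro H ⟨φ⟩ S hS
    refine ⟨fun x => φ.symm x, Subtype.val_injective.comp φ.symm.injective, fun a b => ?_⟩
    rw [← Finset.mem_coe, ← hS, Subgraph.mem_edgeSet]
    constructor
    · intro h
      refine ⟨φ ⟨a, H.edge_vert h⟩, φ ⟨b, H.edge_vert h.symm⟩, ?_, by simp, by simp⟩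
      rw [φ.map_adj_iff]
      exact h
    · rintro ⟨x, y, hxy, rfl, rfl⟩
      exact φ.symm.map_adj_iff.2 hxy
  · rintro S hS ⟨φ, hφ, h⟩
    have hv (x : W) : φ x ∈ (subgraphOfEdges S hS).verts := by
      obtain ⟨y, hy⟩ := hX x
      exact ⟨φ y, (h _ _).2 ⟨x, y, hy, rfl, rfl⟩⟩
    have hbij : Function.Bijective
        (fun x => (⟨φ x, hv x⟩ : (subgraphOfEdges S hS).verts)) := by
      constructor
      · intro x y hxy
        exact hφ (congrArg Subtype.val hxy)
      · rintro ⟨v, w, hw⟩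
        obtain ⟨x, y, -, rfl, rfl⟩ := (h _ _).1 hw
        exact ⟨x, rfl⟩
    refine ⟨RelIso.symm ⟨Equiv.ofBijective _ hbij, ?_⟩⟩
    intro x y
    change s(φ x, φ y) ∈ S ↔ _
    rw [h]
    constructor
    · rintro ⟨x', y', hxy, hx, hy⟩
      rwa [← hφ hx, ← hφ hy]
    · intro hxy
      exact ⟨x, y, hxy, rfl, rfl⟩

end Subgraphs

section DoubleCounting

open Classical in
lemma card_edgesDisjoint_mul {V : Type*} [DecidableEq V] (E : Finset (Sym2 V)) (k : ℕ) :
    (E.powerset.filter fun S => EdgesDisjoint S ∧ S.card = k).card * (E.card - k) =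
      ∑ S ∈ E.powersetCard (k + 1), (S.filter fun e => EdgesDisjoint (S.erase e)).card := by
  have hfib (M) (hM : M ∈ E.powerset.filter fun S => EdgesDisjoint S ∧ S.card = k) :
      (E \ M).card = E.card - k := by
    simp only [Finset.mem_filter, Finset.mem_powerset] at hM
    rw [Finset.card_sdiff_of_subset hM.1, hM.2.2]
  rw [← smul_eq_mul, ← Finset.sum_const, ← Finset.sum_congr rfl hfib, ← Finset.card_sigma,
    ← Finset.card_sigma]
  refine Finset.card_bij' (fun p _ => ⟨insert p.2 p.1, p.2⟩) (fun p _ => ⟨p.1.erase p.2, p.2⟩)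
    ?_ ?_ ?_ ?_
  · rintro ⟨M, e⟩ h
    simp only [Finset.mem_sigma, Finset.mem_filter, Finset.mem_powerset, Finset.mem_sdiff] at h
    obtain ⟨⟨hM, hd, hk⟩, he, heM⟩ := h
    simp [Finset.mem_powersetCard, Finset.insert_subset_iff, he, hM, heM, hk, hd]
  · rintro ⟨S, e⟩ h
    simp only [Finset.mem_sigma, Finset.mem_filter, Finset.mem_powersetCard] at h
    obtain ⟨⟨hS, hk⟩, he, hd⟩ := h
    simp [hd, hS he, (Finset.erase_subset e S).trans hS, Finset.card_erase_of_mem he, hk]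
  · rintro ⟨M, e⟩ h
    simp only [Finset.mem_sigma, Finset.mem_sdiff] at h
    simp [Finset.erase_insert h.2.2]
  · rintro ⟨S, e⟩ h
    simp only [Finset.mem_sigma, Finset.mem_filter] at h
    simp [Finset.insert_erase h.2.1]

open Classical in
lemma card_filter_edgesDisjoint_erase {V : Type*} [DecidableEq V] (S : Finset (Sym2 V)) (hS : 2 < S.card) :
    (S.filter fun e => EdgesDisjoint (S.erase e)).card =
      S.card * (if EdgesDisjoint S then 1 else 0) + 2 * (if HasCherry S then 1 else 0)
        + (if HasBridge S then 1 else 0) := by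
  have h1 := EdgesDisjoint.card_filter (S := S)
  have h2 := HasCherry.card_filter (S := S)
  have h3 := HasBridge.card_filter (S := S)
  by_cases hex : ∃ e ∈ S, EdgesDisjoint (S.erase e)
  · obtain ⟨e, he, h⟩ := hex
    rcases edgesDisjoint_or_hasCherry_or_hasBridge he h with h | h | h <;> split_ifs <;> grind
  · have h0 : (S.filter fun e => EdgesDisjoint (S.erase e)).card = 0 := by
      rw [Finset.card_eq_zero, Finset.filter_eq_empty_iff]
      exact fun e he h => hex ⟨e, he, h⟩
    split_ifs <;> grind

end DoubleCounting

theorem stmt_0 {V : Type*} [Fintype V] [DecidableEq V] (G : SimpleGraph V) [DecidableRel G.Adj]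
    (hreg : G.IsRegularOfDegree 3) (hbip : G.Colorable 2) :
    (numMatchings G 5 : ℤ) * ((G.edgeFinset.card : ℤ) - 5) =
      6 * numMatchings G 6 + 2 * numSubgraphs G (pathGraph 3 ⊕g pathGraph 2 ⊕g pathGraph 2 ⊕g pathGraph 2 ⊕g pathGraph 2)
        + numSubgraphs G (pathGraph 4 ⊕g pathGraph 2 ⊕g pathGraph 2 ⊕g pathGraph 2) := by
  classical
  have c1 := isEdgeCopy_sum_pathGraph_two_iff (V := V) exists_adj_pathGraph_three
    (Q := HasCherry) le_rfl (fun _ h => h.exists_isolated) (fun _ _ h => h.of_erase)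
    (fun _ => isEdgeCopy_pathGraph_three)
  have a1 := exists_adj_sum_pathGraph_two exists_adj_pathGraph_three
  have c2 := isEdgeCopy_sum_pathGraph_two_iff a1 (k := 2) (by norm_num)
    (fun _ h => h.exists_isolated) (fun _ _ h => h.of_erase) c1
  have a2 := exists_adj_sum_pathGraph_two a1
  have c3 := isEdgeCopy_sum_pathGraph_two_iff a2 (k := 2) (by norm_num)
    (fun _ h => h.exists_isolated) (fun _ _ h => h.of_erase) c2
  have a3 := exists_adj_sum_pathGraph_two a2
  have c4 := isEdgeCopy_sum_pathGraph_two_iff a3 (k := 2) (by norm_num)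
    (fun _ h => h.exists_isolated) (fun _ _ h => h.of_erase) c3
  have a4 := exists_adj_sum_pathGraph_two a3
  have d1 := isEdgeCopy_sum_pathGraph_two_iff (V := V) exists_adj_pathGraph_four
    (Q := HasBridge) le_rfl (fun _ h => h.exists_isolated) (fun _ _ h => h.of_erase)
    (fun _ => isEdgeCopy_pathGraph_four)
  have b1 := exists_adj_sum_pathGraph_two exists_adj_pathGraph_four
  have d2 := isEdgeCopy_sum_pathGraph_two_iff b1 (k := 3) (by norm_num)
    (fun _ h => h.exists_isolated) (fun _ _ h => h.of_erase) d1
  have b2 := exists_adj_sum_pathGraph_two b1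
  have d3 := isEdgeCopy_sum_pathGraph_two_iff b2 (k := 3) (by norm_num)
    (fun _ h => h.exists_isolated) (fun _ _ h => h.of_erase) d2
  have b3 := exists_adj_sum_pathGraph_two b2
  have hdiag (S : Finset (Sym2 V)) (hS : S ∈ G.edgeFinset.powerset) : ∀ e ∈ S, ¬ e.IsDiag :=
    fun e he => G.not_isDiag_of_mem_edgeFinset (Finset.mem_powerset.1 hS he)
  have hsplit (Q : Finset (Sym2 V) → Prop) :
      (G.edgeFinset.powerset.filter fun S => Q S ∧ S.card = 6).card =
        ∑ S ∈ G.edgeFinset.powersetCard 6, if Q S then 1 else 0 := by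
    rw [← Finset.card_filter, Finset.powersetCard_eq_filter, Finset.filter_filter]
    simp only [and_comm]
  have hcount : numMatchings G 5 * (G.edgeFinset.card - 5) =
      6 * numMatchings G 6 + 2 * numSubgraphs G
          (pathGraph 3 ⊕g pathGraph 2 ⊕g pathGraph 2 ⊕g pathGraph 2 ⊕g pathGraph 2)
        + numSubgraphs G (pathGraph 4 ⊕g pathGraph 2 ⊕g pathGraph 2 ⊕g pathGraph 2) := by
    rw [numSubgraphs_eq_card a4, numSubgraphs_eq_card b3, numMatchings_eq_card,
      numMatchings_eq_card, Finset.filter_congr fun S hS => c4 S (hdiag S hS),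
      Finset.filter_congr fun S hS => d3 S (hdiag S hS), card_edgesDisjoint_mul,
      hsplit, hsplit, hsplit, Finset.mul_sum, Finset.mul_sum, ← Finset.sum_add_distrib,
      ← Finset.sum_add_distrib]
    refine Finset.sum_congr rfl fun S hS => ?_
    have hcard : S.card = 6 := (Finset.mem_powersetCard.1 hS).2
    rw [card_filter_edgesDisjoint_erase S (by omega), hcard]
  by_cases hm : 5 ≤ G.edgeFinset.card
  · have := congrArg (Nat.cast : ℕ → ℤ) hcount
    push_cast [Nat.cast_sub hm] at this
    exact this
  · have h5 : numMatchings G 5 = 0 := by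
      rw [numMatchings_eq_card, Finset.card_eq_zero, Finset.filter_eq_empty_iff]
      rintro S hS ⟨-, hk⟩
      exact hm (hk ▸ Finset.card_le_card (Finset.mem_powerset.1 hS))
    rw [h5, zero_mul] at hcount
    rw [h5]
    push_cast [← hcount]
    have := congrArg (Nat.cast : ℕ → ℤ) hcount
    push_cast at this
    linarith
end

section
/- Let G be a finite simple 3-regular bipartite graph. Then 20·M(G,5) = 2·N(P₂+4K₂) + 2·N(P₃+3K₂). -/
open SimpleGraph

section Counting

theorem ncard_eq_mul_of_ncard_fiber {A B : Type*} [Finite A] [Finite B] (S : Set A)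
    (Q : A → B → Prop) (c : ℕ) (h : ∀ a ∈ S, {b | Q a b}.ncard = c) :
    {p : A × B | p.1 ∈ S ∧ Q p.1 p.2}.ncard = c * S.ncard := by
  classical
  cases nonempty_fintype A
  cases nonempty_fintype B
  rw [Set.ncard_eq_toFinset_card', Set.ncard_eq_toFinset_card',
    Finset.card_eq_sum_card_fiberwise (f := Prod.fst) (t := S.toFinset) (by intro p hp; simp_all),
    Finset.sum_const_nat (m := c), mul_comm]
  intro a ha
  rw [← h a (by simpa using ha), Set.ncard_eq_toFinset_card']
  refine Finset.card_bij' (fun p _ => p.2) (fun b _ => (a, b)) ?_ ?_ ?_ ?_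
  · rintro ⟨x, y⟩ h
    simp at h ⊢
    obtain ⟨⟨_, h⟩, rfl⟩ := h
    exact h
  · intro b hb
    simp at hb ha ⊢
    exact ⟨ha, hb⟩
  · rintro ⟨x, y⟩ h
    simp at h ⊢
    exact h.2.symm
  · intro b hb
    rfl

end Counting

section Parametrization

variable {V W W' : Type*} {G : SimpleGraph V}

/-- `f` identifies the graph `X` with the subgraph `H`. -/
structure Parametrizes (H : G.Subgraph) (X : SimpleGraph W) (f : W → V) : Prop where
  injective : f.Injective
  verts : H.verts = Set.range f
  adj_iff : ∀ x y, H.Adj (f x) (f y) ↔ X.Adj x y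

theorem nonempty_iso_iff_exists_parametrizes {H : G.Subgraph} {X : SimpleGraph W} :
    Nonempty (H.coe ≃g X) ↔ ∃ f, Parametrizes H X f := by
  constructor
  · rintro ⟨e⟩
    refine ⟨fun x => e.symm x, fun x y h => e.symm.injective (Subtype.ext h), ?_, fun x y => ?_⟩
    · ext v
      constructor
      · intro hv
        exact ⟨e ⟨v, hv⟩, by simp⟩
      · rintro ⟨x, rfl⟩
        exact (e.symm x).2
    · rw [← e.symm.map_adj_iff]
      rfl
  · rintro ⟨f, hf⟩
    let e : W ≃ H.verts := (Equiv.ofInjective f hf.injective).trans (Equiv.setCongr hf.verts.symm)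
    exact ⟨RelIso.symm ⟨e, fun {x y} => hf.adj_iff x y⟩⟩

namespace Parametrizes

variable {H : G.Subgraph} {X : SimpleGraph W} {f : W → V}

theorem mem_verts (hf : Parametrizes H X f) (x : W) : f x ∈ H.verts :=
  hf.verts ▸ Set.mem_range_self x

theorem exists_of_adj (hf : Parametrizes H X f) {a b : V} (h : H.Adj a b) :
    ∃ x y, f x = a ∧ f y = b ∧ X.Adj x y := by
  obtain ⟨x, rfl⟩ := hf.verts ▸ H.edge_vert h
  obtain ⟨y, rfl⟩ := hf.verts ▸ H.edge_vert h.symm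
  exact ⟨x, y, rfl, rfl, (hf.adj_iff x y).1 h⟩

theorem comp_iso (hf : Parametrizes H X f) {Y : SimpleGraph W'} (e : Y ≃g X) :
    Parametrizes H Y (f ∘ e) where
  injective := hf.injective.comp e.injective
  verts := by rw [e.surjective.range_comp, hf.verts]
  adj_iff x y := (hf.adj_iff _ _).trans e.map_adj_iff

end Parametrizes

/-- Ordered pairs of adjacent vertices the first of which has a further neighbour. -/
def forwardBranches (R : V → V → Prop) : Set (V × V) :=
  {p | R p.1 p.2 ∧ ∃ v, v ≠ p.2 ∧ R p.1 v}

/-- Ordered pairs of adjacent vertices each of which has a further neighbour. -/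
def innerBranches (R : V → V → Prop) : Set (V × V) :=
  {p | R p.1 p.2 ∧ (∃ v, v ≠ p.2 ∧ R p.1 v) ∧ ∃ v, v ≠ p.1 ∧ R p.2 v}

theorem Parametrizes.forwardBranches_eq {H : G.Subgraph} {X : SimpleGraph W} {f : W → V}
    (hf : Parametrizes H X f) :
    forwardBranches H.Adj = Prod.map f f '' forwardBranches X.Adj := by
  ext ⟨u, w⟩
  constructor
  · rintro ⟨h, v, hv, huv⟩
    obtain ⟨x, y, rfl, rfl, hxy⟩ := hf.exists_of_adj h
    obtain ⟨x', z, hx, rfl, hxz⟩ := hf.exists_of_adj huv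
    cases hf.injective hx
    exact ⟨(x, y), ⟨hxy, z, fun h => hv (h ▸ rfl), hxz⟩, rfl⟩
  · rintro ⟨⟨x, y⟩, ⟨h, v, hv, hxv⟩, ⟨⟩⟩
    exact ⟨(hf.adj_iff _ _).2 h, f v, hf.injective.ne hv, (hf.adj_iff _ _).2 hxv⟩

theorem Parametrizes.innerBranches_eq {H : G.Subgraph} {X : SimpleGraph W} {f : W → V}
    (hf : Parametrizes H X f) :
    innerBranches H.Adj = Prod.map f f '' innerBranches X.Adj := by
  ext ⟨u, w⟩
  constructor
  · rintro ⟨h, ⟨v, hv, huv⟩, v', hv', hwv'⟩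
    obtain ⟨x, y, rfl, rfl, hxy⟩ := hf.exists_of_adj h
    obtain ⟨x', z, hx, rfl, hxz⟩ := hf.exists_of_adj huv
    obtain ⟨y', z', hy, rfl, hyz⟩ := hf.exists_of_adj hwv'
    cases hf.injective hx
    cases hf.injective hy
    exact ⟨(x, y), ⟨hxy, ⟨z, fun h => hv (h ▸ rfl), hxz⟩, z', fun h => hv' (h ▸ rfl), hyz⟩, rfl⟩
  · rintro ⟨⟨x, y⟩, ⟨h, ⟨v, hv, hxv⟩, v', hv', hyv'⟩, ⟨⟩⟩
    exact ⟨(hf.adj_iff _ _).2 h, ⟨f v, hf.injective.ne hv, (hf.adj_iff _ _).2 hxv⟩,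
      f v', hf.injective.ne hv', (hf.adj_iff _ _).2 hyv'⟩

end Parametrization

section Models

/-- Five disjoint edges, indexed by `Fin 5`. -/
def fiveEdges : SimpleGraph (Fin 5 × Bool) where
  Adj x y := x.1 = y.1 ∧ x.2 ≠ y.2
  symm := ⟨fun _ _ h => ⟨h.1.symm, h.2.symm⟩⟩
  loopless := ⟨fun _ h => h.2 rfl⟩

theorem fiveEdges_adj {x y : Fin 5 × Bool} : fiveEdges.Adj x y ↔ x.1 = y.1 ∧ x.2 ≠ y.2 := Iff.rfl

/-- `fiveEdges` with a new vertex joined to `(0, false)`. -/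
def fiveEdgesPendant : SimpleGraph (Option (Fin 5 × Bool)) :=
  fiveEdges.map some ⊔ edge (some (0, false)) none

/-- `fiveEdges` with its first two edges joined by another edge. -/
def fiveEdgesLinked : SimpleGraph (Fin 5 × Bool) :=
  fiveEdges ⊔ edge (0, false) (1, false)

theorem fiveEdgesPendant_some_some {x y : Fin 5 × Bool} :
    fiveEdgesPendant.Adj (some x) (some y) ↔ fiveEdges.Adj x y := by
  simp only [fiveEdgesPendant, sup_adj, map_adj', edge_adj, Option.some.injEq]
  grind [fiveEdges.ne_of_adj]

theorem fiveEdgesPendant_some_none {x : Fin 5 × Bool} :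
    fiveEdgesPendant.Adj (some x) none ↔ x = (0, false) := by
  simp [fiveEdgesPendant, edge_adj, map_adj']

theorem fiveEdgesPendant_none_some {x : Fin 5 × Bool} :
    fiveEdgesPendant.Adj none (some x) ↔ x = (0, false) := by
  rw [adj_comm, fiveEdgesPendant_some_none]

theorem fiveEdgesLinked_adj {x y : Fin 5 × Bool} : fiveEdgesLinked.Adj x y ↔
    (x.1 = y.1 ∧ x.2 ≠ y.2) ∨
      (x = (0, false) ∧ y = (1, false) ∨ x = (1, false) ∧ y = (0, false)) := by
  simp only [fiveEdgesLinked, sup_adj, edge_adj, fiveEdges_adj]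
  grind

instance : DecidableRel fiveEdges.Adj := fun _ _ => inferInstanceAs (Decidable (_ ∧ _))

instance : DecidableRel fiveEdgesPendant.Adj
  | none, none => isFalse (fiveEdgesPendant.loopless.irrefl _)
  | some _, none => decidable_of_iff _ fiveEdgesPendant_some_none.symm
  | none, some _ => decidable_of_iff _ fiveEdgesPendant_none_some.symm
  | some _, some _ => decidable_of_iff _ fiveEdgesPendant_some_some.symm

instance : DecidableRel fiveEdgesLinked.Adj :=
  fun _ _ => decidable_of_iff _ fiveEdgesLinked_adj.symm

instance {V W : Type*} (X : SimpleGraph V) (Y : SimpleGraph W) [DecidableRel X.Adj]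
    [DecidableRel Y.Adj] : DecidableRel (X ⊕g Y).Adj
  | .inl a, .inl b => decidable_of_iff (X.Adj a b) sum_adj_inl.symm
  | .inr a, .inr b => decidable_of_iff (Y.Adj a b) sum_adj_inr.symm
  | .inl _, .inr _ => isFalse (by simp)
  | .inr _, .inl _ => isFalse (by simp)

instance (n : ℕ) : DecidableRel (pathGraph n).Adj :=
  fun _ _ => decidable_of_iff _ pathGraph_adj.symm

theorem forwardBranches_fiveEdgesPendant : forwardBranches fiveEdgesPendant.Adj =
    {(some (0, false), none), (some (0, false), some (0, true))} := by
  ext ⟨x, y⟩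
  revert x y
  simp only [forwardBranches, Set.mem_ofPred_eq, Set.mem_insert_iff, Set.mem_singleton_iff]
  decide

theorem innerBranches_fiveEdgesLinked : innerBranches fiveEdgesLinked.Adj =
    {((0, false), (1, false)), ((1, false), (0, false))} := by
  ext ⟨x, y⟩
  revert x y
  simp only [innerBranches, Set.mem_ofPred_eq, Set.mem_insert_iff, Set.mem_singleton_iff]
  decide

/-- The automorphism exchanging the two leaves attached to `(0, false)`. -/
def pendantSwap : fiveEdgesPendant ≃g fiveEdgesPendant where
  toEquiv := Equiv.swap none (some (0, true))
  map_rel_iff' {x y} := by revert x y; decide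

/-- The automorphism exchanging the two linked edges. -/
def linkedSwap : fiveEdgesLinked ≃g fiveEdgesLinked where
  toEquiv := (Equiv.swap 0 1).prodCongr (Equiv.refl _)
  map_rel_iff' {x y} := by revert x y; decide

/-- The automorphism of `fiveEdges` given by a permutation of the edges and a set of reversals. -/
def fiveEdgesAut (σ : Equiv.Perm (Fin 5)) (r : Fin 5 → Bool) : fiveEdges ≃g fiveEdges where
  toFun x := (σ x.1, x.2 ^^ r x.1)
  invFun x := (σ.symm x.1, x.2 ^^ r (σ.symm x.1))
  left_inv x := by simp
  right_inv x := by simp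
  map_rel_iff' {x y} := by
    simp only [fiveEdges_adj, Equiv.coe_fn_mk, σ.injective.eq_iff]
    refine and_congr_right fun h => ?_
    rw [h, ne_eq, Bool.xor_left_inj]

theorem nonempty_iso_pendant : Nonempty (fiveEdgesPendant ≃g
    (pathGraph 3 ⊕g pathGraph 2 ⊕g pathGraph 2 ⊕g pathGraph 2 ⊕g pathGraph 2)) := by
  let b : Bool → Fin 2 := fun x => if x then 1 else 0
  let F : Option (Fin 5 × Bool) → (((Fin 3 ⊕ Fin 2) ⊕ Fin 2) ⊕ Fin 2) ⊕ Fin 2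
    | none => .inl (.inl (.inl (.inl 2)))
    | some (0, x) => .inl (.inl (.inl (.inl (if x then 0 else 1))))
    | some (1, x) => .inl (.inl (.inl (.inr (b x))))
    | some (2, x) => .inl (.inl (.inr (b x)))
    | some (3, x) => .inl (.inr (b x))
    | some (4, x) => .inr (b x)
  have hF : F.Bijective := by
    rw [Fintype.bijective_iff_injective_and_card]
    exact ⟨by decide, by simp⟩
  exact ⟨⟨Equiv.ofBijective F hF, fun {x y} => by
    revert x y
    simp only [Equiv.ofBijective_apply]
    decide⟩⟩

theorem nonempty_iso_linked : Nonempty (fiveEdgesLinked ≃g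
    (pathGraph 4 ⊕g pathGraph 2 ⊕g pathGraph 2 ⊕g pathGraph 2)) := by
  let b : Bool → Fin 2 := fun x => if x then 1 else 0
  let F : Fin 5 × Bool → ((Fin 4 ⊕ Fin 2) ⊕ Fin 2) ⊕ Fin 2
    | (0, x) => .inl (.inl (.inl (if x then 0 else 1)))
    | (1, x) => .inl (.inl (.inl (if x then 3 else 2)))
    | (2, x) => .inl (.inl (.inr (b x)))
    | (3, x) => .inl (.inr (b x))
    | (4, x) => .inr (b x)
  have hF : F.Bijective := by
    rw [Fintype.bijective_iff_injective_and_card]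
    exact ⟨by decide, by simp⟩
  exact ⟨⟨Equiv.ofBijective F hF, fun {x y} => by
    revert x y
    simp only [Equiv.ofBijective_apply]
    decide⟩⟩

theorem exists_perm_zero_one {i j : Fin 5} (h : i ≠ j) :
    ∃ σ : Equiv.Perm (Fin 5), σ 0 = i ∧ σ 1 = j := by
  refine ⟨(Equiv.swap 0 i).trans (Equiv.swap (Equiv.swap 0 i 1) j), ?_, ?_⟩ <;>
    revert i j <;> decide

end Models

section Matchings

variable {V : Type*} {G : SimpleGraph V}

/-- `M` is a matching with exactly five edges. -/
def IsFiveMatching (M : G.Subgraph) : Prop := M.IsMatching ∧ M.edgeSet.ncard = 5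

theorem IsFiveMatching.exists_parametrizes {M : G.Subgraph} (hM : IsFiveMatching M) :
    ∃ g, Parametrizes M fiveEdges g := by
  obtain ⟨hM, hcard⟩ := hM
  have : Finite M.edgeSet := Set.finite_of_ncard_ne_zero (by omega)
  obtain ⟨e⟩ : Nonempty (M.edgeSet ≃ Fin 5) := by
    rw [← Nat.card_coe_set_eq] at hcard
    exact ⟨Finite.equivFinOfCardEq hcard⟩
  have hrep : ∀ i, ∃ p : V × V, (e.symm i : Sym2 V) = s(p.1, p.2) := fun i => by
    induction (e.symm i : Sym2 V) with | _ a b => exact ⟨(a, b), rfl⟩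
  choose p hp using hrep
  let g : Fin 5 × Bool → V := fun x => if x.2 then (p x.1).1 else (p x.1).2
  have hadj (i : Fin 5) (b : Bool) : M.Adj (g (i, b)) (g (i, !b)) := by
    have : M.Adj (p i).1 (p i).2 := by
      rw [← Subgraph.mem_edgeSet, ← hp]
      exact (e.symm i).2
    cases b
    · exact this.symm
    · exact this
  have hedge (i : Fin 5) (b : Bool) : (e.symm i : Sym2 V) = s(g (i, b), g (i, !b)) := by
    cases b
    · rw [hp, Sym2.eq_swap]; rfl
    · rw [hp]; rfl
  have hinj : g.Injective := by
    rintro ⟨i, b⟩ ⟨j, c⟩ h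
    have hn : g (i, !b) = g (j, !c) :=
      hM.eq_of_adj_left (hadj i b) (h ▸ hadj j c)
    have hij : i = j := e.symm.injective (Subtype.ext (by rw [hedge i b, hedge j c, h, hn]))
    subst hij
    have hbc : b = c := by
      by_contra hne
      have hc : c = !b := by cases b <;> cases c <;> simp_all
      exact (hadj i b).ne (by rw [h, hc])
    rw [hbc]
  have hpart (x y : Fin 5 × Bool) (h : M.Adj (g x) (g y)) : y = (x.1, !x.2) :=
    hinj (hM.eq_of_adj_left h (hadj x.1 x.2))
  refine ⟨g, hinj, ?_, fun x y => ⟨fun h => ?_, fun h => ?_⟩⟩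
  · ext v
    constructor
    · intro hv
      obtain ⟨w, hw, -⟩ := hM hv
      have hvw := hedge (e ⟨s(v, w), hw⟩) true
      rw [e.symm_apply_apply] at hvw
      rcases Sym2.eq_iff.1 hvw with h | h
      · exact ⟨_, h.1.symm⟩
      · exact ⟨_, h.1.symm⟩
    · rintro ⟨x, rfl⟩
      exact M.edge_vert (hadj x.1 x.2)
  · rw [hpart x y h]
    exact ⟨rfl, by simp⟩
  · obtain ⟨i, b⟩ := x
    obtain ⟨j, c⟩ := y
    obtain ⟨rfl, h⟩ := h
    have hc : c = !b := by cases b <;> cases c <;> simp_all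
    rw [hc]
    exact hadj i b

theorem Parametrizes.isFiveMatching {M : G.Subgraph} {g : Fin 5 × Bool → V}
    (hg : Parametrizes M fiveEdges g) : IsFiveMatching M := by
  constructor
  · intro v hv
    obtain ⟨⟨i, b⟩, rfl⟩ := hg.verts ▸ hv
    refine ⟨g (i, !b), (hg.adj_iff _ _).2 ⟨rfl, by simp⟩, fun w hw => ?_⟩
    obtain ⟨x, ⟨j, c⟩, hx, rfl, h, hbc⟩ := hg.exists_of_adj hw
    cases hg.injective hx
    cases h
    have hc : c = !b := by cases b <;> cases c <;> simp_all
    rw [hc]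
  · have : M.edgeSet = Set.range fun i : Fin 5 => s(g (i, false), g (i, true)) := by
      ext e
      induction e with | _ a b =>
      rw [Subgraph.mem_edgeSet]
      constructor
      · intro h
        obtain ⟨⟨i, b⟩, ⟨j, c⟩, rfl, rfl, h, hbc⟩ := hg.exists_of_adj h
        cases h
        refine ⟨i, ?_⟩
        cases b <;> cases c <;> simp_all [Sym2.eq_swap]
      · rintro ⟨i, h⟩
        rw [← Subgraph.mem_edgeSet, ← h, Subgraph.mem_edgeSet, hg.adj_iff]
        exact ⟨rfl, by simp⟩
    rw [this, ← Nat.card_coe_set_eq, Nat.card_range_of_injective, Nat.card_eq_fintype_card,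
      Fintype.card_fin]
    intro i j h
    rcases Sym2.eq_iff.1 h with h | h
    · exact congrArg Prod.fst (hg.injective h.1)
    · exact congrArg Prod.fst (hg.injective h.1)

/-- Pairs consisting of a vertex `u` of `M` and an edge of `G` from `u` to `w` outside `M`. -/
def ExtendsAt (M : G.Subgraph) (p : V × V) : Prop :=
  p.1 ∈ M.verts ∧ G.Adj p.1 p.2 ∧ ¬ M.Adj p.1 p.2

theorem ncard_extendsAt [Fintype V] [DecidableRel G.Adj] (hreg : G.IsRegularOfDegree 3)
    {M : G.Subgraph} (hM : IsFiveMatching M) : {p | ExtendsAt M p}.ncard = 20 := by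
  classical
  obtain ⟨g, hg⟩ := hM.exists_parametrizes
  have hcard : M.verts.ncard = 10 := by
    rw [hg.verts, ← Nat.card_coe_set_eq, Nat.card_range_of_injective hg.injective]
    simp
  have := ncard_eq_mul_of_ncard_fiber M.verts (fun u w => G.Adj u w ∧ ¬ M.Adj u w) 2 ?_
  · rw [hcard] at this
    exact this
  · intro u hu
    obtain ⟨v, hv, huniq⟩ := hM.1 hu
    have : {w | G.Adj u w ∧ ¬ M.Adj u w} = G.neighborSet u \ {v} := by
      ext w
      refine and_congr_right fun _ => not_congr ⟨fun h => huniq w h, ?_⟩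
      rintro rfl
      exact hv
    rw [this, Set.ncard_sdiff_singleton_of_mem (show v ∈ G.neighborSet u from M.adj_sub hv), ← Nat.card_coe_set_eq,
      Nat.card_eq_fintype_card, card_neighborSet_eq_degree, hreg]

theorem adj_sup_subgraphOfAdj {M : G.Subgraph} {u w a b : V} (h : G.Adj u w) :
    (M ⊔ G.subgraphOfAdj h).Adj a b ↔ M.Adj a b ∨ s(u, w) = s(a, b) := by
  rw [Subgraph.sup_adj, subgraphOfAdj_adj]

theorem exists_parametrizes_pendant {M : G.Subgraph} (hM : IsFiveMatching M) {u w : V}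
    (hu : u ∈ M.verts) (hw : w ∉ M.verts) (h : G.Adj u w) :
    ∃ F, Parametrizes (M ⊔ G.subgraphOfAdj h) fiveEdgesPendant F := by
  obtain ⟨g, hg⟩ := hM.exists_parametrizes
  obtain ⟨⟨i, b⟩, rfl⟩ := hg.verts ▸ hu
  replace hg := hg.comp_iso (fiveEdgesAut (Equiv.swap 0 i) fun _ => b)
  set g' := g ∘ fiveEdgesAut (Equiv.swap 0 i) fun _ => b with hg'
  have h0 : g (i, b) = g' (0, false) := by simp [hg', fiveEdgesAut]
  clear_value g'
  simp only [h0] at *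
  have hne (x) : g' x ≠ w := fun hx => hw (hx ▸ hg.mem_verts x)
  refine ⟨fun x => x.elim w g', ?_, ?_, ?_⟩
  · rintro (_ | x) (_ | y) hxy
    · rfl
    · exact absurd hxy.symm (hne y)
    · exact absurd hxy (hne x)
    · exact congrArg some (hg.injective hxy)
  · ext v
    rw [Subgraph.verts_sup, subgraphOfAdj_verts, hg.verts]
    simp only [Set.mem_union, Set.mem_range, Set.mem_insert_iff, Set.mem_singleton_iff,
      Option.exists, Option.elim]
    grind
  · rintro (_ | x) (_ | y) <;> rw [adj_sup_subgraphOfAdj]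
    · simp only [Option.elim, SimpleGraph.irrefl, iff_false, Sym2.eq_iff]
      grind [hg.mem_verts, M.loopless, M.edge_vert]
    · simp only [Option.elim, fiveEdgesPendant_none_some, Sym2.eq_iff]
      have : ¬ M.Adj w (g' y) := fun h => hw (M.edge_vert h)
      grind [hg.injective.eq_iff]
    · simp only [Option.elim, fiveEdgesPendant_some_none, Sym2.eq_iff]
      have : ¬ M.Adj (g' x) w := fun h => hw (M.edge_vert h.symm)
      grind [hg.injective.eq_iff]
    · simp only [Option.elim, fiveEdgesPendant_some_some, Sym2.eq_iff, hg.adj_iff]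
      grind

theorem exists_parametrizes_linked {M : G.Subgraph} (hM : IsFiveMatching M) {u w : V}
    (hu : u ∈ M.verts) (hw : w ∈ M.verts) (h : G.Adj u w) (huw : ¬ M.Adj u w) :
    ∃ F, Parametrizes (M ⊔ G.subgraphOfAdj h) fiveEdgesLinked F := by
  obtain ⟨g, hg⟩ := hM.exists_parametrizes
  obtain ⟨⟨i, b⟩, rfl⟩ := hg.verts ▸ hu
  obtain ⟨⟨j, c⟩, rfl⟩ := hg.verts ▸ hw
  have hij : i ≠ j := by
    rintro rfl
    rw [hg.adj_iff, fiveEdges_adj] at huw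
    have hbc : b = c := by simpa using huw
    exact h.ne (by rw [hbc])
  obtain ⟨σ, rfl, rfl⟩ := exists_perm_zero_one hij
  let r : Fin 5 → Bool := fun k => if k = 0 then b else c
  replace hg := hg.comp_iso (fiveEdgesAut σ r)
  set g' := g ∘ fiveEdgesAut σ r with hg'
  have h0 : g (σ 0, b) = g' (0, false) := by simp [hg', fiveEdgesAut, r]
  have h1 : g (σ 1, c) = g' (1, false) := by simp [hg', fiveEdgesAut, r]
  clear_value g'
  simp only [h0, h1] at *
  refine ⟨g', hg.injective, ?_, fun x y => ?_⟩
  · rw [Subgraph.verts_sup, subgraphOfAdj_verts, hg.verts]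
    refine Set.union_eq_left.2 ?_
    rintro _ (rfl | rfl) <;> exact Set.mem_range_self _
  · rw [adj_sup_subgraphOfAdj, hg.adj_iff, fiveEdgesLinked_adj, fiveEdges_adj, Sym2.eq_iff]
    simp only [hg.injective.eq_iff]
    grind

end Matchings

section Extensions

variable {V : Type*} {G : SimpleGraph V}

theorem extension_pendant_injective {M M' : G.Subgraph} {u w : V} (h : G.Adj u w)
    (hw : w ∉ M.verts) (hw' : w ∉ M'.verts) (hu : u ∈ M.verts) (hu' : u ∈ M'.verts)
    (heq : M ⊔ G.subgraphOfAdj h = M' ⊔ G.subgraphOfAdj h) : M = M' := by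
  have recover {M : G.Subgraph} (hw : w ∉ M.verts) (hu : u ∈ M.verts) :
      (M ⊔ G.subgraphOfAdj h).deleteVerts {w} = M := by
    ext a b
    · simp only [Subgraph.deleteVerts_verts, Subgraph.verts_sup, subgraphOfAdj_verts]
      grind
    · have : M.Adj a b → a ≠ w ∧ b ≠ w := fun hab =>
        ⟨fun ha => hw (ha ▸ M.edge_vert hab), fun hb => hw (hb ▸ M.edge_vert hab.symm)⟩
      rw [Subgraph.deleteVerts_adj, adj_sup_subgraphOfAdj, Sym2.eq_iff]
      simp only [Subgraph.verts_sup, subgraphOfAdj_verts]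
      have := fun h : M.Adj a b => M.edge_vert h.symm
      grind [M.edge_vert]
  rw [← recover hw hu, heq, recover hw' hu']

theorem extension_linked_injective {M M' : G.Subgraph} {u w : V} (h : G.Adj u w)
    (hw : w ∈ M.verts) (hw' : w ∈ M'.verts) (hu : u ∈ M.verts) (hu' : u ∈ M'.verts)
    (hM : ¬ M.Adj u w) (hM' : ¬ M'.Adj u w)
    (heq : M ⊔ G.subgraphOfAdj h = M' ⊔ G.subgraphOfAdj h) : M = M' := by
  have recover {M : G.Subgraph} (hw : w ∈ M.verts) (hu : u ∈ M.verts) (hM : ¬ M.Adj u w) :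
      (M ⊔ G.subgraphOfAdj h).deleteEdges {s(u, w)} = M := by
    ext a b
    · simp only [Subgraph.deleteEdges_verts, Subgraph.verts_sup, subgraphOfAdj_verts]
      grind
    · have := M.adj_comm u w
      rw [Subgraph.deleteEdges_adj, adj_sup_subgraphOfAdj, Set.mem_singleton_iff, Sym2.eq_iff,
        Sym2.eq_iff]
      grind
  rw [← recover hw hu hM, heq, recover hw' hu' hM']

theorem exists_of_parametrizes_pendant {H : G.Subgraph} {F : Option (Fin 5 × Bool) → V}
    (hF : Parametrizes H fiveEdgesPendant F) (h : G.Adj (F (some (0, false))) (F none)) :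
    ∃ M : G.Subgraph, IsFiveMatching M ∧ F (some (0, false)) ∈ M.verts ∧ F none ∉ M.verts ∧
      M ⊔ G.subgraphOfAdj h = H := by
  have hg : Parametrizes (H.deleteVerts {F none}) fiveEdges (F ∘ some) := by
    refine ⟨hF.injective.comp (Option.some_injective _), ?_, fun x y => ?_⟩
    · ext v
      rw [Subgraph.deleteVerts_verts, hF.verts]
      constructor
      · rintro ⟨⟨_ | x, rfl⟩, hx⟩
        · exact absurd rfl hx
        · exact ⟨x, rfl⟩
      · rintro ⟨x, rfl⟩
        exact ⟨⟨some x, rfl⟩, hF.injective.ne (by simp)⟩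
    · rw [Subgraph.deleteVerts_adj, Function.comp, Function.comp, hF.adj_iff,
        fiveEdgesPendant_some_some]
      simp [hF.mem_verts, hF.injective.eq_iff]
  refine ⟨_, hg.isFiveMatching, hg.mem_verts (0, false), by simp, ?_⟩
  ext a b
  · rw [Subgraph.verts_sup, Subgraph.deleteVerts_verts, subgraphOfAdj_verts]
    have h1 := hF.mem_verts none
    have h2 := hF.mem_verts (some (0, false))
    grind
  · rw [adj_sup_subgraphOfAdj]
    constructor
    · rintro (hab | hab)
      · exact (Subgraph.deleteVerts_adj.1 hab).2.2.2.2
      · rw [← Subgraph.mem_edgeSet, ← hab, Subgraph.mem_edgeSet, hF.adj_iff,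
          fiveEdgesPendant_some_none]
    · intro hab
      obtain ⟨_ | x, _ | y, rfl, rfl, hxy⟩ := hF.exists_of_adj hab
      · exact absurd rfl hxy.ne
      · rw [fiveEdgesPendant_none_some.1 hxy]
        exact .inr Sym2.eq_swap
      · rw [fiveEdgesPendant_some_none.1 hxy]
        exact .inr rfl
      · exact .inl ((hg.adj_iff x y).2 (fiveEdgesPendant_some_some.1 hxy))

theorem exists_of_parametrizes_linked {H : G.Subgraph} {F : Fin 5 × Bool → V}
    (hF : Parametrizes H fiveEdgesLinked F) (h : G.Adj (F (0, false)) (F (1, false))) :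
    ∃ M : G.Subgraph, IsFiveMatching M ∧ F (0, false) ∈ M.verts ∧ F (1, false) ∈ M.verts ∧
      ¬ M.Adj (F (0, false)) (F (1, false)) ∧ M ⊔ G.subgraphOfAdj h = H := by
  have hg : Parametrizes (H.deleteEdges {s(F (0, false), F (1, false))}) fiveEdges F := by
    refine ⟨hF.injective, hF.verts, fun x y => ?_⟩
    rw [Subgraph.deleteEdges_adj, hF.adj_iff, fiveEdgesLinked_adj, Set.mem_singleton_iff,
      Sym2.eq_iff]
    simp only [hF.injective.eq_iff, fiveEdges_adj]
    grind
  refine ⟨_, hg.isFiveMatching, hg.mem_verts _, hg.mem_verts _, by simp, ?_⟩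
  ext a b
  · rw [Subgraph.verts_sup, Subgraph.deleteEdges_verts, subgraphOfAdj_verts]
    have h1 := hF.mem_verts (0, false)
    have h2 := hF.mem_verts (1, false)
    grind
  · rw [adj_sup_subgraphOfAdj, Subgraph.deleteEdges_adj, Set.mem_singleton_iff]
    have hH : H.Adj (F (0, false)) (F (1, false)) := by
      rw [hF.adj_iff, fiveEdgesLinked_adj]
      simp
    have hab : s(F (0, false), F (1, false)) = s(a, b) → H.Adj a b := fun hab => by
      rwa [← Subgraph.mem_edgeSet, ← hab]
    grind

theorem ncard_pendant_extensions :
    {p : G.Subgraph × V × V | IsFiveMatching p.1 ∧ ExtendsAt p.1 p.2 ∧ p.2.2 ∉ p.1.verts}.ncard =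
      {p : G.Subgraph × V × V | (∃ F, Parametrizes p.1 fiveEdgesPendant F) ∧
        p.2 ∈ forwardBranches p.1.Adj}.ncard := by
  refine Set.ncard_congr (fun p hp => (p.1 ⊔ G.subgraphOfAdj hp.2.1.2.1, p.2)) ?_ ?_ ?_
  · rintro ⟨M, u, w⟩ ⟨hM, ⟨hu, h, -⟩, hw⟩
    refine ⟨exists_parametrizes_pendant hM hu hw h, ?_, ?_⟩
    · exact (adj_sup_subgraphOfAdj h).2 (.inr rfl)
    · obtain ⟨v, hv, -⟩ := hM.1 hu
      refine ⟨v, ?_, (adj_sup_subgraphOfAdj h).2 (.inl hv)⟩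
      rintro rfl
      exact hw (M.edge_vert hv.symm)
  · rintro ⟨M, u, w⟩ ⟨M', u', w'⟩ ⟨hM, ⟨hu, h, huw⟩, hw⟩ ⟨hM', ⟨hu', h', huw'⟩, hw'⟩ heq
    obtain ⟨heq, hp⟩ := Prod.ext_iff.1 heq
    cases hp
    exact congrArg (·, u, w) (extension_pendant_injective h hw hw' hu hu' heq)
  · rintro ⟨H, u, w⟩ ⟨⟨F₀, hF₀⟩, hb⟩
    have key : ∃ F, Parametrizes H fiveEdgesPendant F ∧ F (some (0, false)) = u ∧ F none = w := by
      rw [hF₀.forwardBranches_eq, forwardBranches_fiveEdgesPendant] at hb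
      obtain ⟨_, rfl | rfl, ⟨⟩⟩ := hb
      · exact ⟨F₀, hF₀, rfl, rfl⟩
      · exact ⟨_, hF₀.comp_iso pendantSwap, rfl, rfl⟩
    obtain ⟨F, hF, rfl, rfl⟩ := key
    have h : G.Adj (F (some (0, false))) (F none) := H.adj_sub hb.1
    obtain ⟨M, hM, hu, hw, rfl⟩ := exists_of_parametrizes_pendant hF h
    exact ⟨(M, _, _), ⟨hM, ⟨hu, h, fun h => hw (M.edge_vert h.symm)⟩, hw⟩, rfl⟩

theorem ncard_linked_extensions :
    {p : G.Subgraph × V × V | IsFiveMatching p.1 ∧ ExtendsAt p.1 p.2 ∧ p.2.2 ∈ p.1.verts}.ncard =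
      {p : G.Subgraph × V × V | (∃ F, Parametrizes p.1 fiveEdgesLinked F) ∧
        p.2 ∈ innerBranches p.1.Adj}.ncard := by
  refine Set.ncard_congr (fun p hp => (p.1 ⊔ G.subgraphOfAdj hp.2.1.2.1, p.2)) ?_ ?_ ?_
  · rintro ⟨M, u, w⟩ ⟨hM, ⟨hu, h, huw⟩, hw⟩
    refine ⟨exists_parametrizes_linked hM hu hw h huw, ?_, ?_, ?_⟩
    · exact (adj_sup_subgraphOfAdj h).2 (.inr rfl)
    · obtain ⟨v, hv, -⟩ := hM.1 hu
      refine ⟨v, ?_, (adj_sup_subgraphOfAdj h).2 (.inl hv)⟩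
      rintro rfl
      exact huw hv
    · obtain ⟨v, hv, -⟩ := hM.1 hw
      refine ⟨v, ?_, (adj_sup_subgraphOfAdj h).2 (.inl hv)⟩
      rintro rfl
      exact huw hv.symm
  · rintro ⟨M, u, w⟩ ⟨M', u', w'⟩ ⟨hM, ⟨hu, h, huw⟩, hw⟩ ⟨hM', ⟨hu', h', huw'⟩, hw'⟩ heq
    obtain ⟨heq, hp⟩ := Prod.ext_iff.1 heq
    cases hp
    exact congrArg (·, u, w) (extension_linked_injective h hw hw' hu hu' huw huw' heq)
  · rintro ⟨H, u, w⟩ ⟨⟨F₀, hF₀⟩, hb⟩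
    have key : ∃ F, Parametrizes H fiveEdgesLinked F ∧ F (0, false) = u ∧ F (1, false) = w := by
      rw [hF₀.innerBranches_eq, innerBranches_fiveEdgesLinked] at hb
      obtain ⟨_, rfl | rfl, ⟨⟩⟩ := hb
      · exact ⟨F₀, hF₀, rfl, rfl⟩
      · exact ⟨_, hF₀.comp_iso linkedSwap, rfl, rfl⟩
    obtain ⟨F, hF, rfl, rfl⟩ := key
    have h : G.Adj (F (0, false)) (F (1, false)) := H.adj_sub hb.1
    obtain ⟨M, hM, hu, hw, huw, rfl⟩ := exists_of_parametrizes_linked hF h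
    exact ⟨(M, _, _), ⟨hM, ⟨hu, h, huw⟩, hw⟩, rfl⟩

theorem numSubgraphs_eq_of_iso {W W' : Type*} {X : SimpleGraph W} {Y : SimpleGraph W'}
    (e : X ≃g Y) : numSubgraphs G Y = {H : G.Subgraph | ∃ F, Parametrizes H X F}.ncard := by
  rw [numSubgraphs]
  congr 1
  ext H
  exact Iff.trans ⟨fun ⟨i⟩ => ⟨i.trans e.symm⟩, fun ⟨i⟩ => ⟨i.trans e⟩⟩
    nonempty_iso_iff_exists_parametrizes

end Extensions

theorem stmt_1 {V : Type*} [Fintype V] [DecidableEq V] (G : SimpleGraph V) [DecidableRel G.Adj]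
    (hreg : G.IsRegularOfDegree 3) (hbip : G.Colorable 2) :
    20 * numMatchings G 5 = 2 * numSubgraphs G (pathGraph 3 ⊕g pathGraph 2 ⊕g pathGraph 2 ⊕g pathGraph 2 ⊕g pathGraph 2) + 2 * numSubgraphs G (pathGraph 4 ⊕g pathGraph 2 ⊕g pathGraph 2 ⊕g pathGraph 2) := by
  obtain ⟨e⟩ := nonempty_iso_pendant
  obtain ⟨e'⟩ := nonempty_iso_linked
  rw [numSubgraphs_eq_of_iso e, numSubgraphs_eq_of_iso e']
  have hT := ncard_eq_mul_of_ncard_fiber {M : G.Subgraph | IsFiveMatching M} ExtendsAt 20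
    fun M hM => ncard_extendsAt hreg hM
  have hP := ncard_eq_mul_of_ncard_fiber
    {H : G.Subgraph | ∃ F, Parametrizes H fiveEdgesPendant F}
    (fun H p => p ∈ forwardBranches H.Adj) 2 ?_
  · have hL := ncard_eq_mul_of_ncard_fiber
      {H : G.Subgraph | ∃ F, Parametrizes H fiveEdgesLinked F}
      (fun H p => p ∈ innerBranches H.Adj) 2 ?_
    · refine hT.symm.trans (.trans ?_ (congrArg₂ (· + ·)
        (ncard_pendant_extensions.trans hP) (ncard_linked_extensions.trans hL)))
      rw [← Set.ncard_union_eq (Set.disjoint_left.2 fun p hp hp' => hp.2.2 hp'.2.2)]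
      congr 1
      ext p
      simp only [Set.mem_union, Set.mem_ofPred_eq]
      tauto
    · rintro H ⟨F, hF⟩
      change (innerBranches H.Adj).ncard = 2
      rw [hF.innerBranches_eq, innerBranches_fiveEdgesLinked,
        Set.ncard_image_of_injective _ (hF.injective.prodMap hF.injective),
        Set.ncard_pair (by simp)]
  · rintro H ⟨F, hF⟩
    change (forwardBranches H.Adj).ncard = 2
    rw [hF.forwardBranches_eq, forwardBranches_fiveEdgesPendant,
      Set.ncard_image_of_injective _ (hF.injective.prodMap hF.injective),
      Set.ncard_pair (by simp)]
end

section
/- Let G be a finite simple 3-regular bipartite graph. Then 4·N(P₃+2K₂) = 2·N(P₄+2K₂) + 2·N(P₅+K₂) + 8·N(C₄+2K₂). -/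
open SimpleGraph

namespace SimpleGraph

variable {V W : Type*}

/-- The copies of `X` with image `H` are the isomorphisms from `X` onto `H`. -/
theorem card_copy_toSubgraph_eq {G : SimpleGraph V} (X : SimpleGraph W) (H : G.Subgraph) :
    Nat.card {f : Copy X G // f.toSubgraph = H} = Nat.card (X ≃g H.coe) := by
  symm
  refine Nat.card_eq_of_bijective (fun e ↦ ⟨⟨H.hom.comp e.toHom,
    Subgraph.hom_injective.comp e.injective⟩, by simp [Copy.toSubgraph, Subgraph.map_comp]⟩)
    ⟨fun e e' h ↦ ?_, ?_⟩
  · ext a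
    exact congr($(congr_arg Subtype.val h) a)
  · rintro ⟨f, rfl⟩
    exact ⟨f.isoToSubgraph, rfl⟩

theorem card_copy_eq_numSubgraphs_mul [Finite V] [Finite W] (G : SimpleGraph V)
    (X : SimpleGraph W) :
    Nat.card (Copy X G) = numSubgraphs G X * Nat.card (X ≃g X) := by
  have : Finite (Copy X G) := DFunLike.finite _
  have := Fintype.ofFinite {H : G.Subgraph | Nonempty (H.coe ≃g X)}
  let p : Copy X G → {H : G.Subgraph | Nonempty (H.coe ≃g X)} :=
    fun f ↦ ⟨f.toSubgraph, ⟨f.isoToSubgraph.symm⟩⟩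
  have hp (H) : Nat.card {f // p f = H} = Nat.card (X ≃g X) := by
    obtain ⟨e⟩ := H.2
    simp only [p, Subtype.ext_iff]
    rw [card_copy_toSubgraph_eq]
    exact Nat.card_congr ⟨fun g ↦ g.trans e, fun g ↦ g.trans e.symm, fun g ↦ by ext; simp,
      fun g ↦ by ext; simp⟩
  rw [Nat.card_congr (Equiv.sigmaFiberEquiv p).symm, Nat.card_sigma,
    Finset.sum_congr rfl fun H _ ↦ hp H, Finset.sum_const, Finset.card_univ, smul_eq_mul,
    numSubgraphs, ← Nat.card_coe_set_eq, ← Nat.card_eq_fintype_card]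

theorem card_iso_self [Finite W] (X : SimpleGraph W) :
    Nat.card (X ≃g X) = Nat.card (Copy X X) := by
  refine Nat.card_eq_of_bijective (fun e ↦ e.toCopy) ⟨fun e e' h ↦ ?_, fun f ↦ ?_⟩
  · ext a
    exact congr($h a)
  · have hf : Function.Bijective f := Finite.injective_iff_bijective.1 f.injective
    refine ⟨⟨Equiv.ofBijective f hf, fun {a b} ↦ ⟨fun h ↦ ?_, f.toHom.map_adj⟩⟩, rfl⟩
    obtain ⟨⟨e, he⟩, h'⟩ := Finite.surjective_of_injective f.mapEdgeSet.injective ⟨s(f a, f b), h⟩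
    have : Sym2.map f e = Sym2.map f s(a, b) := congr(($h').1)
    rwa [Sym2.map.injective hf.injective this] at he

instance (n : ℕ) : DecidableRel (pathGraph n).Adj :=
  fun _ _ ↦ decidable_of_iff _ pathGraph_adj.symm

instance (G : SimpleGraph V) (H : SimpleGraph W) [DecidableRel G.Adj] [DecidableRel H.Adj] :
    DecidableRel (G ⊕g H).Adj
  | .inl u, .inl v => inferInstanceAs (Decidable (G.Adj u v))
  | .inr u, .inr v => inferInstanceAs (Decidable (H.Adj u v))
  | .inl _, .inr _ => .isFalse (by simp)
  | .inr _, .inl _ => .isFalse (by simp)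

/-- `abcd`, `xy` and `zw` are vertex-disjoint paths in `G`. The redundant inequalities and the
order of the conditions make counting such tuples by a backtracking search fast. -/
abbrev IsP3TwoK2 (G : SimpleGraph V) (a b c d x y z w : V) : Prop :=
  (G.Adj a b ∧ b ≠ a) ∧ (G.Adj b c ∧ c ≠ a ∧ c ≠ b) ∧ (G.Adj c d ∧ d ≠ a ∧ d ≠ b ∧ d ≠ c) ∧
  (x ≠ a ∧ x ≠ b ∧ x ≠ c ∧ x ≠ d) ∧ (G.Adj x y ∧ y ≠ a ∧ y ≠ b ∧ y ≠ c ∧ y ≠ d ∧ y ≠ x) ∧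
  (z ≠ a ∧ z ≠ b ∧ z ≠ c ∧ z ≠ d ∧ z ≠ x ∧ z ≠ y) ∧
  (G.Adj z w ∧ w ≠ a ∧ w ≠ b ∧ w ≠ c ∧ w ≠ d ∧ w ≠ x ∧ w ≠ y ∧ w ≠ z)

variable [Fintype V] [DecidableEq V] (G : SimpleGraph V) [DecidableRel G.Adj]

/-- The labelled copies of `P₃ + 2K₂` in `G`, as tuples of vertices. -/
def p3TwoK2Tuples : Finset (V × V × V × V × V × V × V × V) :=
  {p | IsP3TwoK2 G p.1 p.2.1 p.2.2.1 p.2.2.2.1 p.2.2.2.2.1 p.2.2.2.2.2.1 p.2.2.2.2.2.2.1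
    p.2.2.2.2.2.2.2}

/-- The labelled copies of `C₄ + 2K₂` in `G`, as tuples of vertices. -/
def c4TwoK2Tuples : Finset (V × V × V × V × V × V × V × V) :=
  {p ∈ p3TwoK2Tuples G | G.Adj p.2.2.2.1 p.1}

/-- The labelled copies of `P₅ + K₂` in `G`, as tuples of vertices. -/
def p5K2Tuples : Finset (V × V × V × V × V × V × V × V) :=
  {p ∈ p3TwoK2Tuples G | G.Adj p.2.2.2.1 p.2.2.2.2.1}

/-- The labelled copies of `P₄ + 2K₂` in `G`, as a copy of `P₃ + 2K₂` and the last vertex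
of the longer path. -/
def p4TwoK2Tuples : Finset ((V × V × V × V × V × V × V × V) × V) :=
  {q | IsP3TwoK2 G q.1.1 q.1.2.1 q.1.2.2.1 q.1.2.2.2.1 q.1.2.2.2.2.1 q.1.2.2.2.2.2.1
      q.1.2.2.2.2.2.2.1 q.1.2.2.2.2.2.2.2 ∧ G.Adj q.1.2.2.2.1 q.2 ∧
      q.2 ≠ q.1.1 ∧ q.2 ≠ q.1.2.1 ∧ q.2 ≠ q.1.2.2.1 ∧
      q.2 ≠ q.1.2.2.2.1 ∧ q.2 ≠ q.1.2.2.2.2.1 ∧ q.2 ≠ q.1.2.2.2.2.2.1 ∧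
      q.2 ≠ q.1.2.2.2.2.2.2.1 ∧ q.2 ≠ q.1.2.2.2.2.2.2.2}

theorem card_p3TwoK2Tuples_self :
    (p3TwoK2Tuples (pathGraph 4 ⊕g pathGraph 2 ⊕g pathGraph 2)).card = 16 := by
  simp only [p3TwoK2Tuples, IsP3TwoK2, Finset.card_filter, Fintype.sum_prod_type, ite_and,
    Finset.sum_ite_irrel, Finset.sum_const_zero]
  decide +kernel

theorem card_copy_p3TwoK2 :
    Nat.card (Copy (pathGraph 4 ⊕g pathGraph 2 ⊕g pathGraph 2) G) = (p3TwoK2Tuples G).card := by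
  rw [← Nat.card_eq_finsetCard]
  refine Nat.card_congr
    ⟨fun f ↦ ⟨(f (.inl (.inl 0)), f (.inl (.inl 1)), f (.inl (.inl 2)), f (.inl (.inl 3)),
      f (.inl (.inr 0)), f (.inl (.inr 1)), f (.inr 0), f (.inr 1)), ?_⟩,
     fun p ↦ ⟨⟨Sum.elim (Sum.elim ![p.1.1, p.1.2.1, p.1.2.2.1, p.1.2.2.2.1]
       ![p.1.2.2.2.2.1, p.1.2.2.2.2.2.1]) ![p.1.2.2.2.2.2.2.1, p.1.2.2.2.2.2.2.2], ?_⟩, ?_⟩, ?_, ?_⟩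
  · have h {u v} (huv : _) : G.Adj (f u) (f v) := f.toHom.map_adj huv
    have h' : Function.Injective f := f.injective
    simp [p3TwoK2Tuples, IsP3TwoK2, h'.eq_iff, h, pathGraph_adj]
  · obtain ⟨⟨a, b, c, d, x, y, z, w⟩, h⟩ := p
    simp only [p3TwoK2Tuples, Finset.mem_filter, Finset.mem_univ, true_and] at h
    simp [Sum.forall, Fin.forall_fin_succ, pathGraph_adj]
    grind [G.adj_comm]
  · obtain ⟨⟨a, b, c, d, x, y, z, w⟩, h⟩ := p
    simp only [p3TwoK2Tuples, Finset.mem_filter, Finset.mem_univ, true_and] at h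
    simp [Function.Injective, Sum.forall, Fin.forall_fin_succ]
    grind
  · intro f
    ext a
    rcases a with (a | a) | a <;> fin_cases a <;> rfl
  · intro f
    rfl

theorem card_copy_c4TwoK2 :
    Nat.card (Copy (cycleGraph 4 ⊕g pathGraph 2 ⊕g pathGraph 2) G) = (c4TwoK2Tuples G).card := by
  rw [← Nat.card_eq_finsetCard]
  refine Nat.card_congr
    ⟨fun f ↦ ⟨(f (.inl (.inl 0)), f (.inl (.inl 1)), f (.inl (.inl 2)), f (.inl (.inl 3)),
      f (.inl (.inr 0)), f (.inl (.inr 1)), f (.inr 0), f (.inr 1)), ?_⟩,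
     fun p ↦ ⟨⟨Sum.elim (Sum.elim ![p.1.1, p.1.2.1, p.1.2.2.1, p.1.2.2.2.1]
       ![p.1.2.2.2.2.1, p.1.2.2.2.2.2.1]) ![p.1.2.2.2.2.2.2.1, p.1.2.2.2.2.2.2.2], ?_⟩, ?_⟩, ?_, ?_⟩
  · have h {u v} (huv : _) : G.Adj (f u) (f v) := f.toHom.map_adj huv
    have h' : Function.Injective f := f.injective
    simp [c4TwoK2Tuples, p3TwoK2Tuples, IsP3TwoK2, h'.eq_iff, h, pathGraph_adj, cycleGraph_adj]
    exact h (by decide)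
  · obtain ⟨⟨a, b, c, d, x, y, z, w⟩, h⟩ := p
    simp only [c4TwoK2Tuples, p3TwoK2Tuples, Finset.mem_filter, Finset.mem_univ, true_and] at h
    simp [Sum.forall, Fin.forall_fin_succ, pathGraph_adj, cycleGraph_adj]
    grind [G.adj_comm]
  · obtain ⟨⟨a, b, c, d, x, y, z, w⟩, h⟩ := p
    simp only [c4TwoK2Tuples, p3TwoK2Tuples, Finset.mem_filter, Finset.mem_univ, true_and] at h
    simp [Function.Injective, Sum.forall, Fin.forall_fin_succ]
    grind
  · intro f
    ext a
    rcases a with (a | a) | a <;> fin_cases a <;> rfl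
  · intro f
    rfl

theorem card_copy_p5K2 :
    Nat.card (Copy (pathGraph 6 ⊕g pathGraph 2) G) = (p5K2Tuples G).card := by
  rw [← Nat.card_eq_finsetCard]
  refine Nat.card_congr
    ⟨fun f ↦ ⟨(f (.inl 0), f (.inl 1), f (.inl 2), f (.inl 3),
      f (.inl 4), f (.inl 5), f (.inr 0), f (.inr 1)), ?_⟩,
     fun p ↦ ⟨⟨Sum.elim ![p.1.1, p.1.2.1, p.1.2.2.1, p.1.2.2.2.1,
       p.1.2.2.2.2.1, p.1.2.2.2.2.2.1] ![p.1.2.2.2.2.2.2.1, p.1.2.2.2.2.2.2.2], ?_⟩, ?_⟩, ?_, ?_⟩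
  · have h {u v} (huv : _) : G.Adj (f u) (f v) := f.toHom.map_adj huv
    have h' : Function.Injective f := f.injective
    simp [p5K2Tuples, p3TwoK2Tuples, IsP3TwoK2, h'.eq_iff, h, pathGraph_adj]
  · obtain ⟨⟨a, b, c, d, x, y, z, w⟩, h⟩ := p
    simp only [p5K2Tuples, p3TwoK2Tuples, Finset.mem_filter, Finset.mem_univ, true_and] at h
    simp [Sum.forall, Fin.forall_fin_succ, pathGraph_adj]
    grind [G.adj_comm]
  · obtain ⟨⟨a, b, c, d, x, y, z, w⟩, h⟩ := p
    simp only [p5K2Tuples, p3TwoK2Tuples, Finset.mem_filter, Finset.mem_univ, true_and] at h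
    simp [Function.Injective, Sum.forall, Fin.forall_fin_succ]
    grind
  · intro f
    ext a
    rcases a with a | a <;> fin_cases a <;> rfl
  · intro f
    rfl

theorem card_c4TwoK2Tuples_self :
    (c4TwoK2Tuples (cycleGraph 4 ⊕g pathGraph 2 ⊕g pathGraph 2)).card = 64 := by
  simp only [c4TwoK2Tuples, p3TwoK2Tuples, Finset.filter_filter, IsP3TwoK2, Finset.card_filter,
    Fintype.sum_prod_type, ite_and, Finset.sum_ite_irrel, Finset.sum_const_zero]
  decide +kernel

theorem card_p5K2Tuples_self :
    (p5K2Tuples (pathGraph 6 ⊕g pathGraph 2)).card = 4 := by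
  simp only [p5K2Tuples, p3TwoK2Tuples, Finset.filter_filter, IsP3TwoK2, Finset.card_filter,
    Fintype.sum_prod_type, ite_and, Finset.sum_ite_irrel, Finset.sum_const_zero]
  decide +kernel

theorem card_p4TwoK2Tuples_self :
    (p4TwoK2Tuples (pathGraph 5 ⊕g pathGraph 2 ⊕g pathGraph 2)).card = 16 := by
  simp only [p4TwoK2Tuples, IsP3TwoK2, Finset.card_filter, Fintype.sum_prod_type, ite_and,
    Finset.sum_ite_irrel, Finset.sum_const_zero]
  decide +kernel

theorem card_copy_p4TwoK2 :
    Nat.card (Copy (pathGraph 5 ⊕g pathGraph 2 ⊕g pathGraph 2) G) = (p4TwoK2Tuples G).card := by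
  rw [← Nat.card_eq_finsetCard]
  refine Nat.card_congr
    ⟨fun f ↦ ⟨((f (.inl (.inl 0)), f (.inl (.inl 1)), f (.inl (.inl 2)), f (.inl (.inl 3)),
      f (.inl (.inr 0)), f (.inl (.inr 1)), f (.inr 0), f (.inr 1)), f (.inl (.inl 4))), ?_⟩,
     fun q ↦ ⟨⟨Sum.elim (Sum.elim ![q.1.1.1, q.1.1.2.1, q.1.1.2.2.1, q.1.1.2.2.2.1, q.1.2]
       ![q.1.1.2.2.2.2.1, q.1.1.2.2.2.2.2.1]) ![q.1.1.2.2.2.2.2.2.1, q.1.1.2.2.2.2.2.2.2], ?_⟩, ?_⟩,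
     ?_, ?_⟩
  · have h {u v} (huv : _) : G.Adj (f u) (f v) := f.toHom.map_adj huv
    have h' : Function.Injective f := f.injective
    simp [p4TwoK2Tuples, IsP3TwoK2, h'.eq_iff, h, pathGraph_adj]
  · obtain ⟨⟨⟨a, b, c, d, x, y, z, w⟩, e⟩, h⟩ := q
    simp only [p4TwoK2Tuples, Finset.mem_filter, Finset.mem_univ, true_and] at h
    simp [Sum.forall, Fin.forall_fin_succ, pathGraph_adj]
    grind [G.adj_comm]
  · obtain ⟨⟨⟨a, b, c, d, x, y, z, w⟩, e⟩, h⟩ := q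
    simp only [p4TwoK2Tuples, Finset.mem_filter, Finset.mem_univ, true_and] at h
    simp [Function.Injective, Sum.forall, Fin.forall_fin_succ]
    grind
  · intro f
    ext a
    rcases a with (a | a) | a <;> fin_cases a <;> rfl
  · intro f
    rfl

variable {G}

/-- In a cubic bipartite graph, the last vertex `d` of the path of a labelled copy of `P₃ + 2K₂` has
two further neighbours, each of which is the first vertex of the path, a vertex of one of the two
edges, or a new vertex. -/
theorem two_mul_card_p3TwoK2Tuples (hreg : G.IsRegularOfDegree 3) (hbip : G.Colorable 2) :
    2 * (p3TwoK2Tuples G).card =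
      (p4TwoK2Tuples G).card + 4 * (p5K2Tuples G).card + (c4TwoK2Tuples G).card := by
  have hP4 : (p4TwoK2Tuples G).card = ∑ p ∈ p3TwoK2Tuples G, Finset.card {e |
      G.Adj p.2.2.2.1 e ∧ e ≠ p.1 ∧ e ≠ p.2.1 ∧ e ≠ p.2.2.1 ∧ e ≠ p.2.2.2.1 ∧ e ≠ p.2.2.2.2.1 ∧ e ≠ p.2.2.2.2.2.1 ∧
      e ≠ p.2.2.2.2.2.2.1 ∧ e ≠ p.2.2.2.2.2.2.2} := by
    simp only [p4TwoK2Tuples, Finset.card_filter,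
      Fintype.sum_prod_type (α₁ := V × V × V × V × V × V × V × V),
      ite_and (P := IsP3TwoK2 _ _ _ _ _ _ _ _ _), Finset.sum_ite_irrel, Finset.sum_const_zero,
      p3TwoK2Tuples, Finset.sum_filter]
  have hy : (p5K2Tuples G).card =
      Finset.card {p ∈ p3TwoK2Tuples G | G.Adj p.2.2.2.1 p.2.2.2.2.2.1} := by
    refine Finset.card_nbij' (fun (a, b, c, d, x, y, z, w) ↦ (a, b, c, d, y, x, z, w))
      (fun (a, b, c, d, x, y, z, w) ↦ (a, b, c, d, y, x, z, w)) ?_ ?_ (fun _ _ ↦ rfl) (fun _ _ ↦ rfl)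
    all_goals
      rintro ⟨a, b, c, d, x, y, z, w⟩
      simp only [p5K2Tuples, p3TwoK2Tuples, Finset.coe_filter, Finset.mem_filter,
        Finset.mem_univ, true_and, Set.mem_ofPred_eq]
      clear hP4
      grind [G.adj_comm]
  have hz : (p5K2Tuples G).card =
      Finset.card {p ∈ p3TwoK2Tuples G | G.Adj p.2.2.2.1 p.2.2.2.2.2.2.1} := by
    refine Finset.card_nbij' (fun (a, b, c, d, x, y, z, w) ↦ (a, b, c, d, z, w, x, y))
      (fun (a, b, c, d, x, y, z, w) ↦ (a, b, c, d, z, w, x, y)) ?_ ?_ (fun _ _ ↦ rfl) (fun _ _ ↦ rfl)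
    all_goals
      rintro ⟨a, b, c, d, x, y, z, w⟩
      simp only [p5K2Tuples, p3TwoK2Tuples, Finset.coe_filter, Finset.mem_filter,
        Finset.mem_univ, true_and, Set.mem_ofPred_eq]
      clear hP4
      grind [G.adj_comm]
  have hw : (p5K2Tuples G).card =
      Finset.card {p ∈ p3TwoK2Tuples G | G.Adj p.2.2.2.1 p.2.2.2.2.2.2.2} := by
    refine Finset.card_nbij' (fun (a, b, c, d, x, y, z, w) ↦ (a, b, c, d, z, w, y, x))
      (fun (a, b, c, d, x, y, z, w) ↦ (a, b, c, d, w, z, x, y)) ?_ ?_ (fun _ _ ↦ rfl) (fun _ _ ↦ rfl)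
    all_goals
      rintro ⟨a, b, c, d, x, y, z, w⟩
      simp only [p5K2Tuples, p3TwoK2Tuples, Finset.coe_filter, Finset.mem_filter,
        Finset.mem_univ, true_and, Set.mem_ofPred_eq]
      clear hP4
      grind [G.adj_comm]
  have hx : (p5K2Tuples G).card =
      Finset.card {p ∈ p3TwoK2Tuples G | G.Adj p.2.2.2.1 p.2.2.2.2.1} := rfl
  have hC : (c4TwoK2Tuples G).card = Finset.card {p ∈ p3TwoK2Tuples G | G.Adj p.2.2.2.1 p.1} := rfl
  suffices h : 2 * (p3TwoK2Tuples G).card = (p4TwoK2Tuples G).card +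
      ((p5K2Tuples G).card + (p5K2Tuples G).card + (p5K2Tuples G).card + (p5K2Tuples G).card) + (c4TwoK2Tuples G).card by omega
  nth_rw 2 [hy]
  nth_rw 2 [hz]
  nth_rw 2 [hw]
  rw [hx, hP4, hC, Finset.card_filter, Finset.card_filter, Finset.card_filter, Finset.card_filter,
    Finset.card_filter]
  simp only [← Finset.sum_add_distrib]
  rw [mul_comm, ← smul_eq_mul, ← Finset.sum_const]
  refine Finset.sum_congr rfl ?_
  rintro ⟨a, b, c, d, x, y, z, w⟩ h
  simp only [p3TwoK2Tuples, Finset.mem_filter, Finset.mem_univ, true_and] at h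
  have hdb : ¬ G.Adj d b := by
    obtain ⟨C⟩ := hbip
    have h1 := C.valid h.2.1.1
    have h2 := C.valid h.2.2.1.1
    intro h3
    have h3 := C.valid h3
    omega
  have hd : (G.neighborFinset d).card = 3 := hreg d
  have hS : Finset.card {e ∈ G.neighborFinset d | e ∈ ({c, x, y, z, w, a} : Finset V)} =
      ∑ e ∈ ({c, x, y, z, w, a} : Finset V), if G.Adj d e then 1 else 0 := by
    rw [← Finset.card_filter]
    congr 1
    ext e
    simp [and_comm]
  have hnew : ({e ∈ G.neighborFinset d | e ∉ ({c, x, y, z, w, a} : Finset V)} : Finset V) =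
      ({e | G.Adj d e ∧ e ≠ a ∧ e ≠ b ∧ e ≠ c ∧ e ≠ d ∧ e ≠ x ∧ e ≠ y ∧ e ≠ z ∧ e ≠ w} : Finset V) := by
    ext e
    have := G.irrefl (v := d)
    simp only [Finset.mem_filter, mem_neighborFinset, Finset.mem_univ, true_and, Finset.mem_insert,
      Finset.mem_singleton]
    grind
  rw [← Finset.card_filter_add_card_filter_not (· ∈ ({c, x, y, z, w, a} : Finset V)), hS, hnew,
    Finset.sum_insert (by grind), Finset.sum_insert (by grind), Finset.sum_insert (by grind),
    Finset.sum_insert (by grind), Finset.sum_insert (by grind), Finset.sum_singleton,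
    if_pos h.2.2.1.1.symm] at hd
  dsimp only
  omega

end SimpleGraph

theorem stmt_3 {V : Type*} [Fintype V] [DecidableEq V] (G : SimpleGraph V) [DecidableRel G.Adj]
    (hreg : G.IsRegularOfDegree 3) (hbip : G.Colorable 2) :
    4 * numSubgraphs G (pathGraph 4 ⊕g pathGraph 2 ⊕g pathGraph 2) =
      2 * numSubgraphs G (pathGraph 5 ⊕g pathGraph 2 ⊕g pathGraph 2) + 2 * numSubgraphs G (pathGraph 6 ⊕g pathGraph 2)
        + 8 * numSubgraphs G (cycleGraph 4 ⊕g pathGraph 2 ⊕g pathGraph 2) := by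
  have h := two_mul_card_p3TwoK2Tuples hreg hbip
  have h₁ := card_copy_eq_numSubgraphs_mul G (pathGraph 4 ⊕g pathGraph 2 ⊕g pathGraph 2)
  have h₂ := card_copy_eq_numSubgraphs_mul G (pathGraph 5 ⊕g pathGraph 2 ⊕g pathGraph 2)
  have h₃ := card_copy_eq_numSubgraphs_mul G (pathGraph 6 ⊕g pathGraph 2)
  have h₄ := card_copy_eq_numSubgraphs_mul G (cycleGraph 4 ⊕g pathGraph 2 ⊕g pathGraph 2)
  rw [card_iso_self, card_copy_p3TwoK2, card_copy_p3TwoK2, card_p3TwoK2Tuples_self] at h₁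
  rw [card_iso_self, card_copy_p4TwoK2, card_copy_p4TwoK2, card_p4TwoK2Tuples_self] at h₂
  rw [card_iso_self, card_copy_p5K2, card_copy_p5K2, card_p5K2Tuples_self] at h₃
  rw [card_iso_self, card_copy_c4TwoK2, card_copy_c4TwoK2, card_c4TwoK2Tuples_self] at h₄
  omega
end
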